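/- arXiv:1609.06090 — 12 statements merged into one kernel-verified Lean document; each statement's English description precedes it below -/
import Mathlib

section
/- For every real w > 0 and every complex s with Re(s) > r, one has ∑_{u_1,…,u_r ≥ 0} (a_1u_1+⋯+a_ru_r+w)^{−s} = (1/(D^s (r−1)!)) · ∑_{j_1=0}^{D/a_1−1} ⋯ ∑_{j_r=0}^{D/a_r−1} ∑_{k=0}^{r−1} [r,k] ∑_{j=0}^{k} (−1)^j C(k,j) ((a_1j_1+⋯+a_rj_r+w)/D)^j · ζ(s−k+j, (a_1j_1+⋯+a_rj_r+w)/D). (All Hurwitz zeta values occurring have first argument with real part > 1, so all series converge absolutely.) -/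
/-- Hurwitz zeta function as a series: `ζ(s,w) = ∑_{n≥0} (n+w)^{-s}`. -/
noncomputable def hurwitzZetaSeries (s w : ℂ) : ℂ := ∑' n : ℕ, ((n : ℂ) + w) ^ (-s)

theorem hasSum_hurwitzZetaSeries {s : ℂ} (hs : 1 < s.re) {W : ℝ} (hW : 0 < W) :
    HasSum (fun n : ℕ ↦ ((n : ℂ) + W) ^ (-s)) (hurwitzZetaSeries s W) := by
  refine Summable.hasSum (.of_norm (((Real.summable_one_div_nat_add_rpow W s.re).2 hs).congr ?_))
  intro n
  have h : 0 < (n : ℝ) + W := by positivity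
  rw [abs_of_pos h, ← Complex.ofReal_natCast, ← Complex.ofReal_add,
    Complex.norm_cpow_eq_rpow_re_of_pos h, Complex.neg_re, Real.rpow_neg h.le, one_div]

/-- Number of tuples with a prescribed sum, in product form. -/
theorem card_tuples_sum_eq_mul_factorial (m n : ℕ) :
    Nat.card {q : Fin (m + 1) → ℕ // ∑ i, q i = n} * m.factorial =
      ∏ i ∈ Finset.range m, (n + (i + 1)) := by
  rw [← Nat.card_congr (Sym.equivNatSumOfFintype (Fin (m + 1)) n), Nat.card_eq_fintype_card,
    Sym.card_sym_eq_choose, Fintype.card_fin, show m + 1 + n - 1 = n + m by omega,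
    ← Nat.choose_symm_of_eq_add (show n + m = m + n by omega), mul_comm,
    ← Nat.ascFactorial_eq_factorial_mul_choose, Nat.ascFactorial_eq_prod_range]
  exact Finset.prod_congr rfl fun i _ ↦ by ring

theorem finite_tuples_sum_eq (r n : ℕ) : Finite {q : Fin r → ℕ // ∑ i, q i = n} :=
  .of_equiv _ (Sym.equivNatSumOfFintype (Fin r) n)

/-- Summing a function of `∑ i, q i` over all tuples `q` by grouping equal values. -/
theorem hasSum_comp_sum_tuples {r : ℕ} {f : ℕ → ℂ} {S : ℂ}
    (h : HasSum (fun n ↦ (Nat.card {q : Fin r → ℕ // ∑ i, q i = n} : ℂ) * f n) S) :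
    HasSum (fun q : Fin r → ℕ ↦ f (∑ i, q i)) S := by
  have hfin := finite_tuples_sum_eq r
  have hfiber : ∀ (n : ℕ), HasSum (fun q : {q : Fin r → ℕ // ∑ i, q i = n} ↦ f (∑ i, q.1 i))
      ((Nat.card {q : Fin r → ℕ // ∑ i, q i = n} : ℂ) * f n) := fun n ↦ by
    have := Fintype.ofFinite {q : Fin r → ℕ // ∑ i, q i = n}
    convert hasSum_fintype (fun q : {q : Fin r → ℕ // ∑ i, q i = n} ↦ f (∑ i, q.1 i)) using 1
    rw [Finset.sum_congr rfl fun q _ ↦ by rw [q.2]]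
    simp [Nat.card_eq_fintype_card]
  rw [← (Equiv.sigmaFiberEquiv fun q : Fin r → ℕ ↦ ∑ i, q i).hasSum_iff]
  refine HasSum.sigma_of_hasSum h hfiber (.of_norm ?_)
  refine (summable_sigma_of_nonneg fun _ ↦ norm_nonneg _).2 ⟨fun n ↦ .of_finite, ?_⟩
  refine h.summable.norm.congr fun n ↦ ?_
  have := Fintype.ofFinite {q : Fin r → ℕ // ∑ i, q i = n}
  rw [tsum_fintype]
  simp only [Function.comp_apply, Equiv.sigmaFiberEquiv_apply]
  rw [Finset.sum_congr rfl fun q _ ↦ by rw [q.2]]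
  simp [Nat.card_eq_fintype_card]

/-- A sum over a product with finite first factor can be taken fibrewise. -/
theorem hasSum_prod_of_fintype_left {α β : Type*} [Fintype α] {f : α × β → ℂ} {g : α → ℂ}
    (h : ∀ a, HasSum (fun b ↦ f (a, b)) (g a)) : HasSum f (∑ a, g a) := by
  have hf : Summable f := .of_norm <| (summable_prod_of_nonneg fun _ ↦ norm_nonneg _).2
    ⟨fun a ↦ (h a).summable.norm, .of_finite⟩
  rw [← (hf.hasSum.prod_fiberwise h).unique (hasSum_fintype g)]
  exact hf.hasSum

/-- The Barnes zeta function with all parameters equal to `1`. -/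
theorem hasSum_barnes_one {m : ℕ} {c : ℕ → ℕ}
    (hc : ∀ x : ℂ, ∏ i ∈ Finset.range m, (x + (i + 1 : ℕ)) =
      ∑ k ∈ Finset.range (m + 1), (c k : ℂ) * x ^ k)
    {W : ℝ} (hW : 0 < W) {s : ℂ} (hs : (m + 1 : ℝ) < s.re) :
    HasSum (fun q : Fin (m + 1) → ℕ ↦ (((∑ i, q i : ℕ) : ℂ) + W) ^ (-s))
      (1 / (m.factorial : ℂ) * ∑ k ∈ Finset.range (m + 1), (c k : ℂ) *
        ∑ l ∈ Finset.range (k + 1), (-1) ^ l * (k.choose l : ℂ) * (W : ℂ) ^ l *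
          hurwitzZetaSeries (s - k + l) W) := by
  apply hasSum_comp_sum_tuples (f := fun n ↦ ((n : ℂ) + W) ^ (-s))
  have hsum : HasSum (fun n : ℕ ↦ 1 / (m.factorial : ℂ) * ∑ k ∈ Finset.range (m + 1), (c k : ℂ) *
        ∑ l ∈ Finset.range (k + 1), (-1) ^ l * (k.choose l : ℂ) * (W : ℂ) ^ l *
          ((n : ℂ) + W) ^ (-(s - k + l)))
      (1 / (m.factorial : ℂ) * ∑ k ∈ Finset.range (m + 1), (c k : ℂ) *
        ∑ l ∈ Finset.range (k + 1), (-1) ^ l * (k.choose l : ℂ) * (W : ℂ) ^ l *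
          hurwitzZetaSeries (s - k + l) W) := by
    refine HasSum.mul_left _ (hasSum_sum fun k hk ↦ HasSum.mul_left _ (hasSum_sum fun l _ ↦
      HasSum.mul_left _ (hasSum_hurwitzZetaSeries ?_ hW)))
    have hkm : (k : ℝ) ≤ m := by exact_mod_cast Nat.lt_succ_iff.1 (Finset.mem_range.1 hk)
    have hl : (0 : ℝ) ≤ l := l.cast_nonneg
    simp only [Complex.add_re, Complex.sub_re, Complex.natCast_re]
    linarith
  refine hsum.congr_fun fun n ↦ ?_
  have hne : (n : ℂ) + W ≠ 0 := by
    have h : 0 < (n : ℝ) + W := by positivity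
    exact_mod_cast h.ne'
  have hm : (m.factorial : ℂ) ≠ 0 := by exact_mod_cast m.factorial_ne_zero
  have hcard : (Nat.card {q : Fin (m + 1) → ℕ // ∑ i, q i = n} : ℂ) * m.factorial =
      ∑ k ∈ Finset.range (m + 1), (c k : ℂ) * (n : ℂ) ^ k := by
    rw [← hc]
    exact_mod_cast card_tuples_sum_eq_mul_factorial m n
  have hpow : ∀ k : ℕ, ∑ l ∈ Finset.range (k + 1), (-1) ^ l * (k.choose l : ℂ) * (W : ℂ) ^ l *
      ((n : ℂ) + W) ^ (-(s - k + l)) = (n : ℂ) ^ k * ((n : ℂ) + W) ^ (-s) := fun k ↦ by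
    conv_rhs => rw [show (n : ℂ) = -W + (n + W) by ring, add_pow, Finset.sum_mul]
    refine Finset.sum_congr rfl fun l hl ↦ ?_
    have hlk : l ≤ k := Nat.lt_succ_iff.1 (Finset.mem_range.1 hl)
    have hexp : -(s - k + l) = ((k - l : ℕ) : ℂ) + -s := by push_cast [hlk]; ring
    rw [hexp, Complex.cpow_add _ _ hne, Complex.cpow_natCast, neg_pow,
      show -(W : ℂ) + (n + W) = n by ring]
    ring
  simp only [hpow, ← mul_assoc]
  rw [← Finset.sum_mul, ← hcard]
  field_simp

/-- Division with remainder in every coordinate. -/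
def tupleDivModEquiv {r : ℕ} (d : Fin r → ℕ) [∀ i, NeZero (d i)] :
    (Fin r → ℕ) ≃ (∀ i, Fin (d i)) × (Fin r → ℕ) :=
  ((Equiv.piCongrRight fun i ↦ Nat.divModEquiv (d i)).trans
    (Equiv.arrowProdEquivProdArrow _ _ _)).trans (Equiv.prodComm _ _)

theorem tupleDivModEquiv_symm_apply {r : ℕ} (d : Fin r → ℕ) [∀ i, NeZero (d i)]
    (p : (∀ i, Fin (d i)) × (Fin r → ℕ)) (i : Fin r) :
    (tupleDivModEquiv d).symm p i = p.2 i * d i + p.1 i := rfl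

/-- Lemma 1.1: decomposition of the Barnes zeta function as a combination of
Hurwitz zeta values. -/
theorem barnes_zeta_decomposition
    (r : ℕ) (hr : 1 ≤ r) (a : Fin r → ℕ) (ha : ∀ i, 0 < a i)
    (D : ℕ) (hD : 0 < D) (hdvd : ∀ i, a i ∣ D)
    (c : ℕ → ℕ)
    (hc : ∀ x : ℂ, ∏ i ∈ Finset.range (r - 1), (x + (i + 1 : ℕ)) =
      ∑ k ∈ Finset.range r, (c k : ℂ) * x ^ k)
    (w : ℝ) (hw : 0 < w) (s : ℂ) (hs : (r : ℝ) < s.re) :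
    (∑' u : Fin r → ℕ, (((∑ i, a i * u i : ℕ) : ℂ) + (w : ℂ)) ^ (-s)) =
      1 / ((D : ℂ) ^ s * (Nat.factorial (r - 1) : ℂ)) *
        ∑ j : ∀ i : Fin r, Fin (D / a i),
          ∑ k ∈ Finset.range r,
            (c k : ℂ) *
              ∑ l ∈ Finset.range (k + 1),
                (-1) ^ l * (k.choose l : ℂ) *
                  ((((∑ i, a i * (j i : ℕ) : ℕ) : ℂ) + (w : ℂ)) / (D : ℂ)) ^ l *
                  hurwitzZetaSeries (s - (k : ℂ) + (l : ℂ))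
                    ((((∑ i, a i * (j i : ℕ) : ℕ) : ℂ) + (w : ℂ)) / (D : ℂ)) := by
  obtain ⟨m, rfl⟩ := Nat.exists_eq_add_of_le' hr
  rw [Nat.add_sub_cancel] at hc ⊢
  have hd : ∀ i, NeZero (D / a i) := fun i ↦
    ⟨(Nat.div_pos (Nat.le_of_dvd hD (hdvd i)) (ha i)).ne'⟩
  have hDR : (0 : ℝ) < D := by exact_mod_cast hD
  have hDC : (D : ℂ) ≠ 0 := by exact_mod_cast hD.ne'
  refine HasSum.tsum_eq ?_
  rw [← (tupleDivModEquiv fun i ↦ D / a i).symm.hasSum_iff, Finset.mul_sum]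
  refine hasSum_prod_of_fintype_left fun j ↦ ?_
  obtain ⟨W, hW⟩ : ∃ W : ℝ, W = ((∑ i, a i * (j i : ℕ) : ℕ) + w) / D := ⟨_, rfl⟩
  have hWpos : 0 < W := by rw [hW]; positivity
  have hWC : (((∑ i, a i * (j i : ℕ) : ℕ) : ℂ) + (w : ℂ)) / (D : ℂ) = W := by
    rw [hW]; push_cast; rfl
  have key := (hasSum_barnes_one hc hWpos (by exact_mod_cast hs)).mul_left ((D : ℂ) ^ (-s))
  rw [hWC]
  rw [← one_div_mul_one_div, mul_assoc, one_div ((D : ℂ) ^ s), ← Complex.cpow_neg]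
  refine key.congr_fun fun q ↦ ?_
  have hsum : ∑ i, a i * (tupleDivModEquiv fun i ↦ D / a i).symm (j, q) i =
      D * ∑ i, q i + ∑ i, a i * (j i : ℕ) := by
    rw [Finset.mul_sum, ← Finset.sum_add_distrib]
    refine Finset.sum_congr rfl fun i _ ↦ ?_
    rw [tupleDivModEquiv_symm_apply, mul_add, mul_left_comm, Nat.mul_div_cancel' (hdvd i),
      mul_comm (q i)]
  have hfac : (((D * ∑ i, q i + ∑ i, a i * (j i : ℕ) : ℕ) : ℂ) + w) =
      ((D : ℝ) : ℂ) * (((∑ i, q i : ℕ) + W : ℝ) : ℂ) := by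
    rw [Complex.ofReal_add, ← hWC]
    push_cast
    field_simp
    ring
  rw [Function.comp_apply, hsum, hfac, Complex.mul_cpow_ofReal_nonneg hDR.le (by positivity)]
  push_cast
  rfl
end

section
/- Let d_{a,0},…,d_{a,r−1} : ℕ → ℚ be functions with d_{a,m}(n+D) = d_{a,m}(n) for all n ≥ 0 and p_a(n) = ∑_{m=0}^{r−1} d_{a,m}(n) n^m for all n ≥ 0. Then for every complex s with Re(s) > r, ζ_a(s) = (1/D^s) ∑_{m=0}^{r−1} ∑_{v=1}^{D} d_{a,m}(v) · D^m · ζ(s−m, v/D). -/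
/-- The restricted partition function: the number of tuples `(x₁,…,x_r)` of nonnegative
integers with `a₁x₁+⋯+a_rx_r = n`. -/
noncomputable def restrictedPartition (r : ℕ) (a : Fin r → ℕ) (n : ℕ) : ℕ :=
  Nat.card {x : Fin r → ℕ // ∑ i, a i * x i = n}

/-- A sum over `ℕ` splits as a sum over the residue classes modulo `D`. -/
lemma Summable.tsum_eq_sum_range_tsum_mul_add {f : ℕ → ℂ} (hf : Summable f) {D : ℕ}
    (hD : 0 < D) : ∑' n, f n = ∑ j ∈ Finset.range D, ∑' k, f (k * D + j) := by
  have : NeZero D := ⟨hD.ne'⟩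
  let e : Fin D × ℕ ≃ ℕ := (Equiv.prodComm _ _).trans (Nat.divModEquiv D).symm
  have he (j : Fin D) (k : ℕ) : e (j, k) = k * D + j := rfl
  have hfe : Summable fun p ↦ f (e p) := e.summable_iff.2 hf
  rw [← e.tsum_eq, hfe.tsum_prod, tsum_fintype,
    ← Fin.sum_univ_eq_sum_range (fun j ↦ ∑' k, f (k * D + j))]
  simp only [he]

/-- A Dirichlet series with periodic coefficients converges on `1 < re t`. -/
lemma Function.Periodic.summable_mul_natCast_cpow_neg {c : ℕ → ℂ} {D : ℕ}
    (hc : Function.Periodic c D) (hD : 0 < D) {t : ℂ} (ht : 1 < t.re) :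
    Summable fun n : ℕ ↦ c (n + 1) * ((n + 1 : ℕ) : ℂ) ^ (-t) := by
  have hsum : Summable fun n : ℕ ↦ ‖((n + 1 : ℕ) : ℂ) ^ (-t)‖ := by
    have h := (summable_nat_add_iff 1).2 (Complex.summable_one_div_nat_cpow.2 ht).norm
    simpa only [one_div, Complex.cpow_neg] using h
  refine (hsum.mul_left (∑ j ∈ Finset.range D, ‖c j‖)).of_norm_bounded fun n ↦ ?_
  rw [norm_mul, ← hc.map_mod_nat (n + 1)]
  gcongr
  exact Finset.single_le_sum (f := fun j ↦ ‖c j‖) (fun _ _ ↦ norm_nonneg _)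
    (Finset.mem_range.2 (Nat.mod_lt _ hD))

/-- A Dirichlet series with `D`-periodic coefficients is a combination of `D` Hurwitz zeta
functions. -/
lemma Function.Periodic.tsum_mul_natCast_cpow_neg {c : ℕ → ℂ} {D : ℕ}
    (hc : Function.Periodic c D) (hD : 0 < D) {t : ℂ} (ht : 1 < t.re) :
    ∑' n : ℕ, c (n + 1) * ((n + 1 : ℕ) : ℂ) ^ (-t) =
      (D : ℂ) ^ (-t) * ∑ v ∈ Finset.Icc 1 D, c v * hurwitzZetaSeries t (v / D) := by
  have hD0 : (D : ℂ) ≠ 0 := Nat.cast_ne_zero.2 hD.ne'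
  rw [(hc.summable_mul_natCast_cpow_neg hD ht).tsum_eq_sum_range_tsum_mul_add hD,
    ← Finset.Ico_add_one_right_eq_Icc, Finset.sum_Ico_eq_sum_range, Nat.add_sub_cancel,
    Finset.mul_sum]
  refine Finset.sum_congr rfl fun j _ ↦ ?_
  rw [hurwitzZetaSeries, ← tsum_mul_left, ← tsum_mul_left]
  refine tsum_congr fun k ↦ ?_
  have hper : c (k * D + j + 1) = c (1 + j) := by
    rw [show k * D + j + 1 = 1 + j + k * D by ring]
    exact hc.nat_mul k _
  have hpow : ((k * D + j + 1 : ℕ) : ℂ) ^ (-t) =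
      (D : ℂ) ^ (-t) * (k + ((1 + j : ℕ) : ℂ) / D) ^ (-t) := by
    have h := Complex.mul_cpow_ofReal_nonneg (a := D) (b := k + ((1 + j : ℕ) : ℝ) / D)
      (by positivity) (by positivity) (-t)
    push_cast at h ⊢
    rw [← h]
    congr 1
    field_simp
    ring
  rw [hper, hpow]
  ring

/-- Lemma 1.6: if `p_a(n) = ∑_{m=0}^{r-1} d_{a,m}(n) nᵐ` with `D`-periodic coefficients
`d_{a,m}`, then `ζ_a(s) = (1/Dˢ) ∑_{m=0}^{r−1} ∑_{v=1}^{D} d_{a,m}(v) Dᵐ ζ(s−m, v/D)`. -/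
theorem dirichlet_series_quasipolynomial
    (r : ℕ) (hr : 1 ≤ r) (a : Fin r → ℕ) (ha : ∀ i, 0 < a i)
    (D : ℕ) (hD : 0 < D) (hdvd : ∀ i, a i ∣ D)
    (d : ℕ → ℕ → ℚ)
    (hper : ∀ m n, d m (n + D) = d m n)
    (hrep : ∀ n : ℕ, (restrictedPartition r a n : ℚ) =
      ∑ m ∈ Finset.range r, d m n * (n : ℚ) ^ m)
    (s : ℂ) (hs : (r : ℝ) < s.re) :
    (∑' n : ℕ, (restrictedPartition r a (n + 1) : ℂ) * (((n + 1 : ℕ)) : ℂ) ^ (-s)) =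
      1 / (D : ℂ) ^ s *
        ∑ m ∈ Finset.range r, ∑ v ∈ Finset.Icc 1 D,
          (d m v : ℂ) * (D : ℂ) ^ m * hurwitzZetaSeries (s - (m : ℂ)) ((v : ℂ) / (D : ℂ)) := by
  have hre (m : ℕ) (hm : m ∈ Finset.range r) : 1 < (s - m).re := by
    have : (m : ℝ) + 1 ≤ r := mod_cast Finset.mem_range.1 hm
    simp only [Complex.sub_re, Complex.natCast_re]
    linarith
  have hc (m : ℕ) : Function.Periodic (fun n ↦ (d m n : ℂ)) D := fun n ↦ by
    simp only [hper]
  have hterm (n : ℕ) : (restrictedPartition r a (n + 1) : ℂ) * ((n + 1 : ℕ) : ℂ) ^ (-s) =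
      ∑ m ∈ Finset.range r, (d m (n + 1) : ℂ) * ((n + 1 : ℕ) : ℂ) ^ (-(s - m)) := by
    have h : (restrictedPartition r a (n + 1) : ℂ) =
        ∑ m ∈ Finset.range r, (d m (n + 1) : ℂ) * ((n + 1 : ℕ) : ℂ) ^ m :=
      mod_cast congrArg (Rat.cast : ℚ → ℂ) (hrep (n + 1))
    rw [h, Finset.sum_mul]
    refine Finset.sum_congr rfl fun m _ ↦ ?_
    rw [neg_sub, sub_eq_add_neg, Complex.cpow_add _ _ (Nat.cast_ne_zero.2 n.succ_ne_zero),
      Complex.cpow_natCast, mul_assoc]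
  simp_rw [hterm]
  rw [Summable.tsum_finsetSum fun m hm ↦ (hc m).summable_mul_natCast_cpow_neg hD (hre m hm),
    Finset.mul_sum]
  refine Finset.sum_congr rfl fun m hm ↦ ?_
  rw [(hc m).tsum_mul_natCast_cpow_neg hD (hre m hm), neg_sub, sub_eq_add_neg,
    Complex.cpow_add _ _ (Nat.cast_ne_zero.2 hD.ne'), Complex.cpow_natCast, Complex.cpow_neg,
    one_div, Finset.mul_sum, Finset.mul_sum]
  exact Finset.sum_congr rfl fun v _ ↦ by ring
end

section
/- Let k ≥ 1 and r ≥ 0 be integers. The functions s ↦ ζ(s−j, ℓ/k), for 0 ≤ j ≤ r and 1 ≤ ℓ ≤ k, are linearly independent over ℂ: if complex numbers c_{jℓ} satisfy ∑_{ℓ=1}^{k} ∑_{j=0}^{r} c_{jℓ} · ζ(s−j, ℓ/k) = 0 for every complex s with Re(s) > r+1, then c_{jℓ} = 0 for all j, ℓ. -/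
/-- The Dirichlet coefficients of `k ^ (-s) * ζ(s - j, l / k)`. -/
noncomputable def hurwitzCoeff (k j l m : ℕ) : ℂ :=
  if m % k = l % k then ((m : ℂ) / k) ^ j else 0

lemma norm_hurwitzCoeff_le {k : ℕ} (hk : 1 ≤ k) (j l m : ℕ) :
    ‖hurwitzCoeff k j l m‖ ≤ (m : ℝ) ^ j := by
  unfold hurwitzCoeff
  split_ifs
  · rw [norm_pow, norm_div, Complex.norm_natCast, Complex.norm_natCast]
    gcongr
    exact div_le_self (by positivity) (by exact_mod_cast hk)
  · simp

lemma lseriesSummable_hurwitzCoeff {k : ℕ} (hk : 1 ≤ k) (j l : ℕ) {s : ℂ}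
    (hs : (j : ℝ) + 1 < s.re) : LSeriesSummable (hurwitzCoeff k j l) s := by
  refine LSeriesSummable_of_le_const_mul_rpow hs ⟨1, fun m _ ↦ ?_⟩
  simpa using norm_hurwitzCoeff_le hk j l m

lemma lseries_hurwitzCoeff {k : ℕ} (hk : 1 ≤ k) (j : ℕ) {l : ℕ} (hl : 1 ≤ l) (hlk : l ≤ k)
    (s : ℂ) : LSeries (hurwitzCoeff k j l) s =
      (k : ℂ) ^ (-s) * hurwitzZetaSeries (s - j) ((l : ℂ) / k) := by
  have hk0 : (k : ℂ) ≠ 0 := by exact_mod_cast (by lia : k ≠ 0)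
  have hinj : Function.Injective fun n : ℕ ↦ k * n + l := fun a b hab ↦
    Nat.eq_of_mul_eq_mul_left hk (Nat.add_right_cancel hab)
  have hsupp : Function.support (LSeries.term (hurwitzCoeff k j l) s) ⊆
      Set.range fun n : ℕ ↦ k * n + l := by
    intro m hm
    have hm0 : m ≠ 0 := by
      rintro rfl
      simp at hm
    have hmod : m % k = l % k := by
      by_contra hne
      simp [LSeries.term, hurwitzCoeff, hne] at hm
    have hlm : l ≤ m := by
      rcases hlk.eq_or_lt with rfl | hlt
      · rw [Nat.mod_self] at hmod
        exact Nat.le_of_dvd (by lia) (Nat.dvd_of_mod_eq_zero hmod)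
      · rw [Nat.mod_eq_of_lt hlt] at hmod
        exact hmod ▸ Nat.mod_le m k
    obtain ⟨n, hn⟩ := (Nat.modEq_iff_dvd' hlm).mp (show l ≡ m [MOD k] from hmod.symm)
    exact ⟨n, by simp only; lia⟩
  rw [LSeries, ← hinj.tsum_eq hsupp, hurwitzZetaSeries, ← tsum_mul_left]
  refine tsum_congr fun n ↦ ?_
  have hm0 : k * n + l ≠ 0 := by lia
  have hmC : ((k * n + l : ℕ) : ℂ) ≠ 0 := by exact_mod_cast hm0
  have hdiv : (n : ℂ) + l / k = ((k * n + l : ℕ) : ℂ) / k := by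
    push_cast
    field_simp
  have hpow : ((k * n + l : ℕ) : ℂ) ^ (-s) =
      (((k * n + l : ℕ) : ℂ) / k) ^ (-s) * (k : ℂ) ^ (-s) := by
    have := Complex.mul_cpow_ofReal_nonneg (a := ((k * n + l : ℕ) : ℝ) / k) (b := (k : ℝ))
      (by positivity) (by positivity) (-s)
    rw [Complex.ofReal_div, Complex.ofReal_natCast, Complex.ofReal_natCast,
      div_mul_cancel₀ _ hk0] at this
    exact this
  rw [LSeries.term_of_ne_zero hm0, hurwitzCoeff, if_pos (by simp), hdiv,
    show -(s - (j : ℂ)) = -s + j by ring, Complex.cpow_add _ _ (div_ne_zero hmC hk0),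
    Complex.cpow_natCast, div_eq_mul_inv _ (((k * n + l : ℕ) : ℂ) ^ s), ← Complex.cpow_neg, hpow]
  ring

/-- Lemma 1.7: the functions `s ↦ ζ(s−j, ℓ/k)`, `0 ≤ j ≤ r`, `1 ≤ ℓ ≤ k`, are linearly
independent over `ℂ`. -/
theorem hurwitzZeta_linearIndependent
    (k : ℕ) (hk : 1 ≤ k) (r : ℕ) (c : ℕ → ℕ → ℂ)
    (h : ∀ s : ℂ, (r : ℝ) + 1 < s.re →
      ∑ l ∈ Finset.Icc 1 k, ∑ j ∈ Finset.range (r + 1),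
        c j l * hurwitzZetaSeries (s - (j : ℂ)) ((l : ℂ) / (k : ℂ)) = 0) :
    ∀ j ≤ r, ∀ l, 1 ≤ l → l ≤ k → c j l = 0 := by
  intro j hj l hl hlk
  set a : ℕ → ℂ := ∑ l ∈ Finset.Icc 1 k, ∑ j ∈ Finset.range (r + 1),
    c j l • hurwitzCoeff k j l with ha
  have hterm : ∀ s : ℂ, (r : ℝ) + 1 < s.re → ∀ l, ∀ j ∈ Finset.range (r + 1),
      LSeriesSummable (c j l • hurwitzCoeff k j l) s := by
    intro s hs l j hj
    refine (lseriesSummable_hurwitzCoeff hk j l (lt_of_le_of_lt ?_ hs)).smul _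
    have : (j : ℝ) ≤ r := by exact_mod_cast Finset.mem_range_succ_iff.mp hj
    linarith
  have hinner : ∀ s : ℂ, (r : ℝ) + 1 < s.re → ∀ l ∈ Finset.Icc 1 k,
      LSeriesSummable (∑ j ∈ Finset.range (r + 1), c j l • hurwitzCoeff k j l) s :=
    fun s hs l _ ↦ LSeriesSummable.sum (hterm s hs l)
  have hzero : ∀ s : ℂ, (r : ℝ) + 1 < s.re → LSeries a s = 0 := by
    intro s hs
    rw [ha, LSeries_sum (hinner s hs), ← mul_zero ((k : ℂ) ^ (-s)), ← h s hs, Finset.mul_sum]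
    refine Finset.sum_congr rfl fun l hl ↦ ?_
    rw [Finset.mem_Icc] at hl
    rw [LSeries_sum (hterm s hs l), Finset.mul_sum]
    refine Finset.sum_congr rfl fun j _ ↦ ?_
    rw [LSeries_smul, lseries_hurwitzCoeff hk j hl.1 hl.2]
    ring
  have habs : LSeries.abscissaOfAbsConv a ≠ ⊤ := by
    have hs : (r : ℝ) + 1 < ((r + 2 : ℝ) : ℂ).re := by
      rw [Complex.ofReal_re]
      linarith
    exact ((LSeriesSummable.sum (hinner _ hs)).abscissaOfAbsConv_le.trans_lt
      (EReal.coe_lt_top _)).ne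
  have hcoeff : ∀ m ≠ 0, a m = 0 := by
    refine (LSeries_eventually_eq_zero_iff'.mp ?_).resolve_right habs
    filter_upwards [Filter.eventually_gt_atTop ((r : ℝ) + 1)] with x hx
    exact hzero x (by simpa using hx)
  have heval : ∀ n : ℕ, ∑ j ∈ Finset.range (r + 1),
      c j l * (((k * n + l : ℕ) : ℂ) / k) ^ j = 0 := by
    intro n
    have hm := hcoeff (k * n + l) (by lia)
    rw [ha, Finset.sum_apply, Finset.sum_eq_single_of_mem l (Finset.mem_Icc.mpr ⟨hl, hlk⟩)] at hm
    · simpa [hurwitzCoeff] using hm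
    · intro l' hl' hne
      rw [Finset.mem_Icc] at hl'
      have hmod : ¬ l % k = l' % k := by
        intro heq
        rcases hlk.eq_or_lt with rfl | hlt <;> rcases hl'.2.eq_or_lt with rfl | hlt'
        · exact hne rfl
        · rw [Nat.mod_self, Nat.mod_eq_of_lt hlt'] at heq
          lia
        · rw [Nat.mod_self, Nat.mod_eq_of_lt hlt] at heq
          lia
        · rw [Nat.mod_eq_of_lt hlt, Nat.mod_eq_of_lt hlt'] at heq
          exact hne heq.symm
      simp [hurwitzCoeff, hmod]
  set p : Polynomial ℂ := ∑ j ∈ Finset.range (r + 1), Polynomial.C (c j l) * Polynomial.X ^ j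
    with hp
  have hk0 : (k : ℂ) ≠ 0 := by exact_mod_cast (by lia : k ≠ 0)
  have hp0 : p = 0 := by
    refine p.eq_zero_of_infinite_isRoot
      ((Set.infinite_range_of_injective (f := fun n : ℕ ↦ ((k * n + l : ℕ) : ℂ) / k) ?_).mono ?_)
    · intro x y hxy
      have hxy' : k * x + l = k * y + l := by
        exact_mod_cast (div_left_inj' hk0).mp hxy
      exact Nat.eq_of_mul_eq_mul_left hk (Nat.add_right_cancel hxy')
    · rintro _ ⟨n, rfl⟩
      simpa [hp, Polynomial.IsRoot, Polynomial.eval_finsetSum] using heval n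
  have hcj : p.coeff j = c j l := by
    simp [hp, Polynomial.finsetSum_coeff, Polynomial.coeff_X_pow, Nat.lt_succ_of_le hj]
  rw [← hcj, hp0, Polynomial.coeff_zero]
end

section
/- Let d_{a,0},…,d_{a,r−1} : ℕ → ℚ be functions with d_{a,m}(n+D) = d_{a,m}(n) for all n ≥ 0 and p_a(n) = ∑_{m=0}^{r−1} d_{a,m}(n) n^m for all n ≥ 0. Then for every 0 ≤ m ≤ r−1 and every n ≥ 0, d_{a,m}(n) = (1/(r−1)!) ∑_{(j_1,…,j_r): 0 ≤ j_i ≤ D/a_i − 1 for all i, a_1j_1+⋯+a_rj_r ≡ n (mod D)} ∑_{k=m}^{r−1} [r,k] (−1)^{k−m} C(k,m) D^{−k} (a_1j_1+⋯+a_rj_r)^{k−m}. -/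
/-- Stars and bars for functions on a nonempty finite type `Fin r`. -/
theorem card_fin_fun_sum_eq (r : ℕ) (hr : 1 ≤ r) (t : ℕ) :
    Nat.card {y : Fin r → ℕ // ∑ i, y i = t} = (t + (r - 1)).choose (r - 1) := by
  have e : {y : Fin r → ℕ // ∑ i, y i = t} ≃
      (Finset.univ : Finset (Fin r)).finsuppAntidiag t :=
    (Finsupp.equivFunOnFinite.subtypeEquiv fun f => by
      simp [Finset.mem_finsuppAntidiag]).symm
  rw [Nat.card_congr e, Nat.card_eq_fintype_card, Fintype.card_coe,
    Finset.card_finsuppAntidiag_nat_eq_choose, Finset.card_univ, Fintype.card_fin,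
    ← Nat.choose_symm_add]
  congr 1
  omega

/-- Division with remainder by `D / a i` in each coordinate: solutions of `∑ aᵢxᵢ = N` are
fibred over the remainder vectors. -/
def solutionsEquivSigma {r : ℕ} (a : Fin r → ℕ) (ha : ∀ i, 0 < a i)
    {D : ℕ} (hD : 0 < D) (hdvd : ∀ i, a i ∣ D) (N : ℕ) :
    {x : Fin r → ℕ // ∑ i, a i * x i = N} ≃
      Σ j : ∀ i : Fin r, Fin (D / a i),
        {y : Fin r → ℕ // ∑ i, a i * (j i : ℕ) + D * ∑ i, y i = N} where
  toFun x := ⟨fun i => ⟨x.1 i % (D / a i), Nat.mod_lt _ (Nat.div_pos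
      (Nat.le_of_dvd hD (hdvd i)) (ha i))⟩, fun i => x.1 i / (D / a i), by
    refine Eq.trans ?_ x.2
    rw [Finset.mul_sum, ← Finset.sum_add_distrib]
    refine Finset.sum_congr rfl fun i _ => ?_
    conv_rhs => rw [← Nat.mod_add_div (x.1 i) (D / a i)]
    rw [mul_add, ← mul_assoc (a i) (D / a i), Nat.mul_div_cancel' (hdvd i)]⟩
  invFun p := ⟨fun i => (p.1 i : ℕ) + D / a i * p.2.1 i, by
    conv_rhs => rw [← p.2.2]
    rw [Finset.mul_sum, ← Finset.sum_add_distrib]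
    refine Finset.sum_congr rfl fun i _ => ?_
    rw [mul_add, ← mul_assoc (a i) (D / a i), Nat.mul_div_cancel' (hdvd i)]⟩
  left_inv x := Subtype.ext (funext fun i => Nat.mod_add_div _ _)
  right_inv := by
    rintro ⟨j, y, hy⟩
    have hpos (i) : 0 < D / a i := Nat.div_pos (Nat.le_of_dvd hD (hdvd i)) (ha i)
    have h1 : (fun i => (⟨((j i : ℕ) + D / a i * y i) % (D / a i),
        Nat.mod_lt _ (hpos i)⟩ : Fin (D / a i))) = j := by
      funext i
      apply Fin.ext
      simp [Nat.mod_eq_of_lt (j i).2]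
    have h2 : (fun i => ((j i : ℕ) + D / a i * y i) / (D / a i)) = y := by
      funext i
      rw [Nat.add_mul_div_left _ _ (hpos i), Nat.div_eq_of_lt (j i).2, zero_add]
    refine Sigma.ext h1 ?_
    refine (Subtype.heq_iff_coe_eq fun z => ?_).2 h2
    exact iff_of_eq (congrArg
      (fun j : ∀ i, Fin (D / a i) => ∑ i, a i * (j i : ℕ) + D * ∑ i, z i = N) h1)

theorem card_sum_fibre {r : ℕ} (hr : 1 ≤ r) {D : ℕ} (hD : 0 < D) {S N : ℕ} (hS : S ≤ N) :
    Nat.card {y : Fin r → ℕ // S + D * ∑ i, y i = N} =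
      if S % D = N % D then ((N - S) / D + (r - 1)).choose (r - 1) else 0 := by
  split_ifs with h
  · rw [← card_fin_fun_sum_eq r hr]
    have hd : D ∣ N - S := (Nat.modEq_iff_dvd' hS).1 h
    refine Nat.card_congr (Equiv.subtypeEquivRight fun y => ?_)
    rw [eq_comm (b := (N - S) / D), Nat.div_eq_iff_eq_mul_right hD hd]
    omega
  · have : IsEmpty {y : Fin r → ℕ // S + D * ∑ i, y i = N} :=
      ⟨fun y => h (by rw [← y.2, Nat.add_mul_mod_self_left])⟩
    exact Nat.card_of_isEmpty

theorem sum_mul_fin_le {r : ℕ} (a : Fin r → ℕ) {D : ℕ} (j : ∀ i : Fin r, Fin (D / a i)) :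
    ∑ i, a i * (j i : ℕ) ≤ r * D := by
  calc ∑ i, a i * (j i : ℕ) ≤ ∑ _i : Fin r, D := Finset.sum_le_sum fun i _ =>
        (Nat.mul_le_mul_left _ (j i).2.le).trans (Nat.mul_div_le _ _)
    _ = r * D := by simp

theorem restrictedPartition_eq_sum_choose (r : ℕ) (hr : 1 ≤ r) (a : Fin r → ℕ)
    (ha : ∀ i, 0 < a i) (D : ℕ) (hD : 0 < D) (hdvd : ∀ i, a i ∣ D) (N : ℕ) (hN : r * D ≤ N) :
    restrictedPartition r a N =
      ∑ j ∈ Finset.univ.filter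
          (fun j : ∀ i : Fin r, Fin (D / a i) => (∑ i, a i * (j i : ℕ)) % D = N % D),
        ((N - ∑ i, a i * (j i : ℕ)) / D + (r - 1)).choose (r - 1) := by
  have hfin (j : ∀ i : Fin r, Fin (D / a i)) :
      Finite {y : Fin r → ℕ // ∑ i, a i * (j i : ℕ) + D * ∑ i, y i = N} := by
    refine Set.Finite.subset (Set.finite_Iic (fun _ : Fin r => N)) fun y hy i => ?_
    have hy : ∑ i, a i * (j i : ℕ) + D * ∑ i, y i = N := hy
    have h1 : y i ≤ ∑ i, y i := Finset.single_le_sum (fun _ _ => Nat.zero_le _)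
      (Finset.mem_univ i)
    have h2 : ∑ i, y i ≤ D * ∑ i, y i := Nat.le_mul_of_pos_left _ hD
    show y i ≤ N
    omega
  rw [restrictedPartition, Nat.card_congr (solutionsEquivSigma a ha hD hdvd N), Nat.card_sigma,
    Finset.sum_filter]
  exact Finset.sum_congr rfl fun j _ => card_sum_fibre hr hD ((sum_mul_fin_le a j).trans hN)

theorem choose_cast_eq (r : ℕ) (c : ℕ → ℕ)
    (hc : ∀ x : ℚ, ∏ i ∈ Finset.range (r - 1), (x + (i + 1 : ℕ)) =
      ∑ k ∈ Finset.range r, (c k : ℚ) * x ^ k) (t : ℕ) :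
    ((t + (r - 1)).choose (r - 1) : ℚ) =
      1 / (Nat.factorial (r - 1) : ℚ) * ∑ k ∈ Finset.range r, (c k : ℚ) * (t : ℚ) ^ k := by
  rw [← hc, one_div, eq_inv_mul_iff_mul_eq₀ (by positivity)]
  have h := Nat.ascFactorial_eq_factorial_mul_choose t (r - 1)
  rw [Nat.ascFactorial_eq_prod_range] at h
  rw [← Nat.cast_mul, ← h]
  push_cast
  exact Finset.prod_congr rfl fun i _ => by ring

theorem sum_mul_div_pow (r : ℕ) (hr : 1 ≤ r) (c : ℕ → ℚ) (D x s : ℚ) :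
    ∑ k ∈ Finset.range r, c k * ((x - s) / D) ^ k =
      ∑ m ∈ Finset.range r, (∑ k ∈ Finset.Icc m (r - 1),
        c k * (-1) ^ (k - m) * (k.choose m : ℚ) * D ^ (-(k : ℤ)) * s ^ (k - m)) * x ^ m := by
  simp_rw [Finset.sum_mul]
  rw [Finset.sum_comm' (t' := Finset.range r) (s' := fun k => Finset.range (k + 1))
    (by intro m k; simp only [Finset.mem_range, Finset.mem_Icc]; omega)]
  refine Finset.sum_congr rfl fun k _ => ?_
  rw [div_pow, sub_eq_add_neg, add_pow, Finset.sum_div, Finset.mul_sum]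
  refine Finset.sum_congr rfl fun m _ => ?_
  rw [zpow_neg, zpow_natCast, neg_pow s]
  ring

theorem coeff_eq_of_infinite (r : ℕ) (u v : ℕ → ℚ) (s : Set ℚ) (hs : s.Infinite)
    (h : ∀ x ∈ s, ∑ m ∈ Finset.range r, u m * x ^ m = ∑ m ∈ Finset.range r, v m * x ^ m)
    (m : ℕ) (hm : m < r) : u m = v m := by
  have key := Polynomial.eq_of_infinite_eval_eq
    (∑ m ∈ Finset.range r, Polynomial.monomial m (u m))
    (∑ m ∈ Finset.range r, Polynomial.monomial m (v m))
    (hs.mono fun x hx => by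
      simpa [Polynomial.eval_finsetSum, Polynomial.eval_monomial] using h x hx)
  simpa [Polynomial.finsetSum_coeff, Polynomial.coeff_monomial, hm] using
    congrArg (fun p => Polynomial.coeff p m) key

/-- Theorem 1.8(1): an explicit formula for the coefficients `d_{a,m}` of the
quasi-polynomial `p_a(n) = ∑_{m=0}^{r-1} d_{a,m}(n) nᵐ` of period `D`. -/
theorem restrictedPartition_coefficients
    (r : ℕ) (hr : 1 ≤ r) (a : Fin r → ℕ) (ha : ∀ i, 0 < a i)
    (D : ℕ) (hD : 0 < D) (hdvd : ∀ i, a i ∣ D)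
    (c : ℕ → ℕ)
    (hc : ∀ x : ℚ, ∏ i ∈ Finset.range (r - 1), (x + (i + 1 : ℕ)) =
      ∑ k ∈ Finset.range r, (c k : ℚ) * x ^ k)
    (d : ℕ → ℕ → ℚ)
    (hper : ∀ m n, d m (n + D) = d m n)
    (hrep : ∀ n : ℕ, (restrictedPartition r a n : ℚ) =
      ∑ m ∈ Finset.range r, d m n * (n : ℚ) ^ m) :
    ∀ m ≤ r - 1, ∀ n : ℕ,
      d m n = 1 / (Nat.factorial (r - 1) : ℚ) *
        ∑ j ∈ Finset.univ.filter
            (fun j : ∀ i : Fin r, Fin (D / a i) => (∑ i, a i * (j i : ℕ)) % D = n % D),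
          ∑ k ∈ Finset.Icc m (r - 1),
            (c k : ℚ) * (-1) ^ (k - m) * (k.choose m : ℚ) * (D : ℚ) ^ (-(k : ℤ)) *
              ((∑ i, a i * (j i : ℕ) : ℕ) : ℚ) ^ (k - m) := by
  intro m hm n
  have hinj : Function.Injective fun q : ℕ => ((n + (r + q) * D : ℕ) : ℚ) := by
    intro p q hpq
    have : n + (r + p) * D = n + (r + q) * D := Nat.cast_injective (R := ℚ) hpq
    have := Nat.eq_of_mul_eq_mul_right hD (Nat.add_left_cancel this)
    omega
  refine coeff_eq_of_infinite r (fun m => d m n) (fun m => 1 / (Nat.factorial (r - 1) : ℚ) *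
    ∑ j ∈ Finset.univ.filter
        (fun j : ∀ i : Fin r, Fin (D / a i) => (∑ i, a i * (j i : ℕ)) % D = n % D),
      ∑ k ∈ Finset.Icc m (r - 1),
        (c k : ℚ) * (-1) ^ (k - m) * (k.choose m : ℚ) * (D : ℚ) ^ (-(k : ℤ)) *
          ((∑ i, a i * (j i : ℕ) : ℕ) : ℚ) ^ (k - m)) _
    (Set.infinite_range_of_injective hinj) ?_ m (by omega)
  rintro _ ⟨q, rfl⟩
  have hd (m : ℕ) : d m n = d m (n + (r + q) * D) := by
    have hp : Function.Periodic (d m) D := hper m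
    exact ((hp.nat_mul (r + q)) n).symm
  have hN : r * D ≤ n + (r + q) * D := by nlinarith
  have hmod : (n + (r + q) * D) % D = n % D := Nat.add_mul_mod_self_right _ _ _
  simp only [hd]
  rw [← hrep, restrictedPartition_eq_sum_choose r hr a ha D hD hdvd _ hN, hmod]
  generalize n + (r + q) * D = N at hN hmod ⊢
  simp_rw [mul_assoc (1 / _ : ℚ), ← Finset.mul_sum, Finset.sum_mul]
  rw [Finset.sum_comm, Nat.cast_sum, Finset.mul_sum]
  refine Finset.sum_congr rfl fun j hj => ?_
  have hS := (sum_mul_fin_le a j).trans hN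
  have hdiv : D ∣ N - ∑ i, a i * (j i : ℕ) :=
    (Nat.modEq_iff_dvd' hS).1 ((Finset.mem_filter.1 hj).2.trans hmod.symm)
  simp_rw [← Finset.sum_mul]
  rw [choose_cast_eq r c hc, Nat.cast_div hdiv (by positivity), Nat.cast_sub hS,
    sum_mul_div_pow r hr fun k => (c k : ℚ)]
end

section
/- For every n ≥ 0, p_a(n) = (1/(r−1)!) ∑_{m=0}^{r−1} ∑_{(j_1,…,j_r): 0 ≤ j_i ≤ D/a_i − 1 for all i, a_1j_1+⋯+a_rj_r ≡ n (mod D)} ∑_{k=m}^{r−1} [r,k] (−1)^{k−m} C(k,m) D^{−k} (a_1j_1+⋯+a_rj_r)^{k−m} · n^m. -/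
/-- Stars and bars: the number of `r`-tuples of natural numbers with sum `t`. -/
theorem natCard_sum_eq (r t : ℕ) (hr : 1 ≤ r) :
    Nat.card {y : Fin r → ℕ // ∑ i, y i = t} = (t + (r - 1)).choose (r - 1) := by
  have e : {y : Fin r → ℕ // ∑ i, y i = t} ≃
      (Finset.finsuppAntidiag (Finset.univ : Finset (Fin r)) t) :=
    (Finsupp.equivFunOnFinite.symm.subtypeEquiv (by intro y; simp))
  rw [Nat.card_congr e, Nat.card_eq_fintype_card, Fintype.card_coe,
    Finset.card_finsuppAntidiag_nat_eq_choose, Finset.card_univ, Fintype.card_fin,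
    show r + t - 1 = t + (r - 1) by omega]
  exact (Nat.choose_symm_add (a := t) (b := r - 1))

theorem cast_choose_eq_prod (k t : ℕ) :
    (((t + k).choose k : ℕ) : ℚ) =
      1 / (k.factorial : ℚ) * ∏ i ∈ Finset.range k, ((t : ℚ) + (i + 1 : ℕ)) := by
  have h := Nat.ascFactorial_eq_factorial_mul_choose t k
  rw [Nat.ascFactorial_eq_prod_range] at h
  have h' : ∏ i ∈ Finset.range k, ((t : ℚ) + (i + 1 : ℕ)) = k.factorial * (t + k).choose k := by
    rw [← Nat.cast_mul, ← h, Nat.cast_prod]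
    refine Finset.prod_congr rfl fun i _ => ?_
    push_cast
    ring
  have hk : (k.factorial : ℚ) ≠ 0 := by exact_mod_cast k.factorial_ne_zero
  rw [h']
  field_simp

theorem finite_sum_dilate_eq (r S D n : ℕ) (hD : 0 < D) :
    Finite {y : Fin r → ℕ // S + D * ∑ i, y i = n} := by
  refine Set.Finite.to_subtype ((Set.finite_Iic (fun _ : Fin r => n)).subset ?_)
  intro y hy i
  have h1 : y i ≤ ∑ i, y i := Finset.single_le_sum (fun _ _ => Nat.zero_le _) (Finset.mem_univ i)
  have h2 : ∑ i, y i ≤ D * ∑ i, y i := Nat.le_mul_of_pos_left _ hD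
  have h3 : S + D * ∑ i, y i = n := hy
  show y i ≤ n
  omega

/-- The number of tuples with `S + D (y₁ + ⋯ + y_r) = n`, as a polynomial in `(n - S) / D`
valid as soon as `S < r D`. -/
theorem natCard_sum_dilate_eq (r S D n : ℕ) (hr : 1 ≤ r) (hD : 0 < D) (hS : S < r * D) :
    (Nat.card {y : Fin r → ℕ // S + D * ∑ i, y i = n} : ℚ) =
      if S % D = n % D then
        1 / ((r - 1).factorial : ℚ) *
          ∏ i ∈ Finset.range (r - 1), (((n : ℚ) - S) / D + (i + 1 : ℕ))
      else 0 := by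
  have hD' : (D : ℚ) ≠ 0 := by exact_mod_cast hD.ne'
  split_ifs with h
  · rcases le_or_gt S n with hle | hlt
    · obtain ⟨t, ht⟩ := (Nat.modEq_iff_dvd' hle).1 h
      obtain rfl : n = S + D * t := by omega
      have e : {y : Fin r → ℕ // S + D * ∑ i, y i = S + D * t} ≃
          {y : Fin r → ℕ // ∑ i, y i = t} :=
        Equiv.subtypeEquivRight fun y => by simp [hD.ne']
      rw [Nat.card_congr e, natCard_sum_eq r t hr, cast_choose_eq_prod]
      have : (((S + D * t : ℕ) : ℚ) - S) / D = t := by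
        push_cast
        field_simp
        ring
      rw [this]
    · have : IsEmpty {y : Fin r → ℕ // S + D * ∑ i, y i = n} := ⟨fun y => by have := y.2; omega⟩
      rw [Nat.card_of_isEmpty]
      obtain ⟨t, ht⟩ := (Nat.modEq_iff_dvd' hlt.le).1 h.symm
      obtain rfl : S = n + D * t := by omega
      have ht0 : 0 < t := by
        rcases Nat.eq_zero_or_pos t with rfl | h0
        · simp at hlt
        · exact h0
      have htr : t < r := by
        refine Nat.lt_of_mul_lt_mul_left (a := D) ?_
        rw [mul_comm D r]
        omega
      rw [Finset.prod_eq_zero (i := t - 1) (by simp; omega), mul_zero, Nat.cast_zero]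
      rw [Nat.sub_add_cancel ht0]
      push_cast
      field_simp
      ring
  · have : IsEmpty {y : Fin r → ℕ // S + D * ∑ i, y i = n} :=
      ⟨fun y => h (by rw [← y.2, Nat.add_mul_mod_self_left])⟩
    rw [Nat.card_of_isEmpty, Nat.cast_zero]

/-- Coordinatewise division with remainder. -/
def piDivModEquiv {r : ℕ} (b : Fin r → ℕ) (hb : ∀ i, 0 < b i) :
    (Fin r → ℕ) ≃ (∀ i, Fin (b i)) × (Fin r → ℕ) where
  toFun x := (fun i => ⟨x i % b i, Nat.mod_lt _ (hb i)⟩, fun i => x i / b i)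
  invFun p i := p.1 i + b i * p.2 i
  left_inv x := by
    funext i
    exact Nat.mod_add_div _ _
  right_inv p := by
    ext i
    · simp [Nat.mod_eq_of_lt (p.1 i).2]
    · simp [Nat.add_mul_div_left _ _ (hb i), Nat.div_eq_of_lt (p.1 i).2]

theorem restrictedPartition_eq_sum (r : ℕ) (a : Fin r → ℕ) (ha : ∀ i, 0 < a i)
    (D : ℕ) (hD : 0 < D) (hdvd : ∀ i, a i ∣ D) (n : ℕ) :
    restrictedPartition r a n = ∑ j : ∀ i : Fin r, Fin (D / a i),
      Nat.card {y : Fin r → ℕ // (∑ i, a i * (j i : ℕ)) + D * ∑ i, y i = n} := by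
  have hb : ∀ i, 0 < D / a i := fun i => Nat.div_pos (Nat.le_of_dvd hD (hdvd i)) (ha i)
  have := fun j : ∀ i : Fin r, Fin (D / a i) =>
    finite_sum_dilate_eq r (∑ i, a i * (j i : ℕ)) D n hD
  rw [← Nat.card_sigma, restrictedPartition]
  refine Nat.card_congr (Equiv.trans ?_ (Equiv.subtypeProdEquivSigmaSubtype
    fun (j : ∀ i : Fin r, Fin (D / a i)) (y : Fin r → ℕ) =>
      (∑ i, a i * (j i : ℕ)) + D * ∑ i, y i = n))
  refine (Equiv.subtypeEquiv (piDivModEquiv (fun i => D / a i) hb).symm fun p => ?_).symm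
  have : ∑ i, a i * (piDivModEquiv (fun i => D / a i) hb).symm p i =
      (∑ i, a i * (p.1 i : ℕ)) + D * ∑ i, p.2 i := by
    rw [Finset.mul_sum, ← Finset.sum_add_distrib]
    refine Finset.sum_congr rfl fun i _ => ?_
    change a i * (p.1 i + D / a i * p.2 i) = _
    rw [mul_add, ← mul_assoc, Nat.mul_div_cancel' (hdvd i)]
  rw [this]

theorem sum_mul_lt {r : ℕ} (hr : 1 ≤ r) (a : Fin r → ℕ) (ha : ∀ i, 0 < a i)
    (D : ℕ) (hdvd : ∀ i, a i ∣ D) (j : ∀ i : Fin r, Fin (D / a i)) :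
    ∑ i, a i * (j i : ℕ) < r * D := by
  have : Nonempty (Fin r) := ⟨⟨0, hr⟩⟩
  calc ∑ i, a i * (j i : ℕ) < ∑ _i : Fin r, D := by
        refine Finset.sum_lt_sum_of_nonempty Finset.univ_nonempty fun i _ => ?_
        calc a i * (j i : ℕ) < a i * (D / a i) := Nat.mul_lt_mul_of_pos_left (j i).2 (ha i)
          _ = D := Nat.mul_div_cancel' (hdvd i)
    _ = r * D := by simp

/-- Binomial expansion of a polynomial in `(n - S) / D`. -/
theorem sum_mul_sub_div_pow (r : ℕ) (hr : 1 ≤ r) (c : ℕ → ℚ) (D S n : ℚ) :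
    ∑ m ∈ Finset.range r, ∑ k ∈ Finset.Icc m (r - 1),
      c k * (-1) ^ (k - m) * (k.choose m : ℚ) * D ^ (-(k : ℤ)) * S ^ (k - m) * n ^ m =
    ∑ k ∈ Finset.range r, c k * ((n - S) / D) ^ k := by
  rw [Finset.sum_comm' (t' := Finset.range r) (s' := fun k => Finset.range (k + 1))
    (by intro m k; simp only [Finset.mem_range, Finset.mem_Icc]; omega)]
  refine Finset.sum_congr rfl fun k _ => ?_
  rw [div_pow, sub_eq_add_neg, add_pow, div_eq_mul_inv, Finset.sum_mul, Finset.mul_sum]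
  refine Finset.sum_congr rfl fun m _ => ?_
  rw [zpow_neg, zpow_natCast, neg_pow S]
  ring

/-- Theorem 1.8(2): an explicit formula for the restricted partition function. -/
theorem restrictedPartition_formula
    (r : ℕ) (hr : 1 ≤ r) (a : Fin r → ℕ) (ha : ∀ i, 0 < a i)
    (D : ℕ) (hD : 0 < D) (hdvd : ∀ i, a i ∣ D)
    (c : ℕ → ℕ)
    (hc : ∀ x : ℚ, ∏ i ∈ Finset.range (r - 1), (x + (i + 1 : ℕ)) =
      ∑ k ∈ Finset.range r, (c k : ℚ) * x ^ k)
    (n : ℕ) :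
    (restrictedPartition r a n : ℚ) =
      1 / (Nat.factorial (r - 1) : ℚ) *
        ∑ m ∈ Finset.range r,
          ∑ j ∈ Finset.univ.filter
              (fun j : ∀ i : Fin r, Fin (D / a i) => (∑ i, a i * (j i : ℕ)) % D = n % D),
            ∑ k ∈ Finset.Icc m (r - 1),
              (c k : ℚ) * (-1) ^ (k - m) * (k.choose m : ℚ) * (D : ℚ) ^ (-(k : ℤ)) *
                ((∑ i, a i * (j i : ℕ) : ℕ) : ℚ) ^ (k - m) * (n : ℚ) ^ m := by
  rw [restrictedPartition_eq_sum r a ha D hD hdvd n, Nat.cast_sum, Finset.sum_comm,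
    Finset.mul_sum, Finset.sum_filter]
  refine Finset.sum_congr rfl fun j _ => ?_
  rw [natCard_sum_dilate_eq r _ D n hr hD (sum_mul_lt hr a ha D hdvd j),
    sum_mul_sub_div_pow r hr (fun k => (c k : ℚ)), hc]
end

section
/- Let g := gcd(a_1,…,a_r). For n ≥ 0 let B_n := { (j_1,…,j_r) : 0 ≤ j_1 ≤ D/a_1 − 1, …, 0 ≤ j_r ≤ D/a_r − 1, a_1j_1+⋯+a_rj_r ≡ n (mod D) }. Then the cardinality of B_n equals g·D^{r−1}/(a_1⋯a_r) if g divides n, and equals 0 if g does not divide n. -/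
/-- A subgroup containing the multiples `a i • x` contains `gcd a • x`. -/
lemma AddSubgroup.finset_gcd_nsmul_mem {ι G : Type*} [AddCommGroup G] (H : AddSubgroup G)
    (s : Finset ι) (a : ι → ℕ) (x : G) (h : ∀ i ∈ s, a i • x ∈ H) : s.gcd a • x ∈ H := by
  classical
  induction s using Finset.induction_on with
  | empty => simp
  | insert i s _ ih =>
    rw [Finset.gcd_insert]
    have h₁ := h i (Finset.mem_insert_self i s)
    have h₂ := ih fun k hk => h k (Finset.mem_insert_of_mem hk)
    have key : gcd (a i) (s.gcd a) • x =
        (a i).gcdA (s.gcd a) • (a i • x) + (a i).gcdB (s.gcd a) • (s.gcd a • x) := by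
      rw [← natCast_zsmul, ← natCast_zsmul x (a i), ← natCast_zsmul x (s.gcd a), ← mul_zsmul,
        ← mul_zsmul, ← add_zsmul]
      congr 1
      change ((Nat.gcd (a i) (s.gcd a) : ℕ) : ℤ) = _
      rw [Nat.gcd_eq_gcd_ab]
      ring
    rw [key]
    exact H.add_mem (H.zsmul_mem h₁ _) (H.zsmul_mem h₂ _)

/-- Multiplication by a divisor `a` of `D`, as a homomorphism `ZMod (D / a) →+ ZMod D`. -/
def ZMod.mulDivisorHom {D a : ℕ} (h : a ∣ D) : ZMod (D / a) →+ ZMod D :=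
  ZMod.lift (D / a) ⟨(AddMonoidHom.mulLeft (a : ZMod D)).comp (Int.castAddHom (ZMod D)), by
    simp only [AddMonoidHom.comp_apply, Int.coe_castAddHom, AddMonoidHom.coe_mulLeft,
      Int.cast_natCast]
    rw [← Nat.cast_mul, Nat.mul_div_cancel' h, ZMod.natCast_self]⟩

lemma ZMod.mulDivisorHom_natCast {D a : ℕ} (h : a ∣ D) (k : ℕ) :
    ZMod.mulDivisorHom h (k : ZMod (D / a)) = ((a * k : ℕ) : ZMod D) := by
  have := ZMod.lift_coe (D / a) ⟨(AddMonoidHom.mulLeft (a : ZMod D)).comp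
    (Int.castAddHom (ZMod D)), by
      simp only [AddMonoidHom.comp_apply, Int.coe_castAddHom, AddMonoidHom.coe_mulLeft,
        Int.cast_natCast]
      rw [← Nat.cast_mul, Nat.mul_div_cancel' h, ZMod.natCast_self]⟩ (k : ℤ)
  simpa [ZMod.mulDivisorHom] using this

/-- The residues modulo `m` as an equivalence between `Fin m` and `ZMod m`. -/
def ZMod.finCastEquiv (m : ℕ) [NeZero m] : Fin m ≃ ZMod m where
  toFun k := ((k : ℕ) : ZMod m)
  invFun z := ⟨z.val, z.val_lt⟩
  left_inv k := Fin.ext (ZMod.val_cast_of_lt k.isLt)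
  right_inv z := ZMod.natCast_zmod_val z

/-- The homomorphism `(j i) ↦ ∑ i, a i * j i` from `∏ i, ZMod (D / a i)` to `ZMod D`. -/
def ZMod.sumMulDivisorHom {ι : Type*} [Fintype ι] {a : ι → ℕ} {D : ℕ} (h : ∀ i, a i ∣ D) :
    (∀ i, ZMod (D / a i)) →+ ZMod D :=
  ∑ i, (ZMod.mulDivisorHom (h i)).comp (Pi.evalAddMonoidHom _ i)

lemma ZMod.sumMulDivisorHom_apply {ι : Type*} [Fintype ι] {a : ι → ℕ} {D : ℕ}
    (h : ∀ i, a i ∣ D) (z : ∀ i, ZMod (D / a i)) :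
    ZMod.sumMulDivisorHom h z = ∑ i, ZMod.mulDivisorHom (h i) (z i) := by
  simp [ZMod.sumMulDivisorHom]

lemma ZMod.range_sumMulDivisorHom {ι : Type*} [Fintype ι] {a : ι → ℕ} {D : ℕ}
    (h : ∀ i, a i ∣ D) :
    (ZMod.sumMulDivisorHom h).range =
      AddSubgroup.zmultiples ((Finset.univ.gcd a : ℕ) : ZMod D) := by
  classical
  apply le_antisymm
  · rintro _ ⟨z, rfl⟩
    rw [ZMod.sumMulDivisorHom_apply]
    refine AddSubgroup.sum_mem _ fun i _ => ?_
    obtain ⟨k, hk⟩ := ZMod.intCast_surjective (z i)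
    obtain ⟨c, hc⟩ := Finset.gcd_dvd (f := a) (Finset.mem_univ i)
    have h1 : ZMod.mulDivisorHom (h i) (1 : ZMod (D / a i)) = ((a i : ℕ) : ZMod D) := by
      simpa using ZMod.mulDivisorHom_natCast (h i) 1
    rw [← hk, ← zsmul_one, map_zsmul, h1]
    refine AddSubgroup.zsmul_mem _ ?_ _
    rw [hc, mul_comm, Nat.cast_mul, ← nsmul_eq_mul]
    exact AddSubgroup.nsmul_mem _ (AddSubgroup.mem_zmultiples _) _
  · rw [AddSubgroup.zmultiples_le, ← nsmul_one]
    refine AddSubgroup.finset_gcd_nsmul_mem _ _ _ _ fun i _ => ⟨Pi.single i 1, ?_⟩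
    rw [ZMod.sumMulDivisorHom_apply, Finset.sum_eq_single i]
    · simpa using ZMod.mulDivisorHom_natCast (h i) 1
    · intro k _ hk
      simp [Pi.single_eq_of_ne hk]
    · simp

lemma ZMod.natCast_mem_zmultiples_iff {D g : ℕ} (h : g ∣ D) (n : ℕ) :
    (n : ZMod D) ∈ AddSubgroup.zmultiples (g : ZMod D) ↔ g ∣ n := by
  constructor
  · rintro ⟨k, hk⟩
    have hk' : ((k * g : ℤ) : ZMod D) = ((n : ℤ) : ZMod D) := by simpa using hk
    rw [ZMod.intCast_eq_intCast_iff_dvd_sub] at hk'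
    have h1 : (g : ℤ) ∣ n - k * g := (Int.natCast_dvd_natCast.mpr h).trans hk'
    exact Int.natCast_dvd_natCast.mp ((dvd_sub_left (dvd_mul_left _ _)).mp h1)
  · rintro ⟨c, rfl⟩
    rw [mul_comm, Nat.cast_mul, ← nsmul_eq_mul]
    exact AddSubgroup.nsmul_mem _ (AddSubgroup.mem_zmultiples _) _

/-- Remark 1.11: the number of tuples `(j₁,…,j_r)` with `0 ≤ jᵢ ≤ D/aᵢ − 1` and
`a₁j₁+⋯+a_rj_r ≡ n (mod D)` equals `g·D^{r−1}/(a₁⋯a_r)` if `g = gcd(a₁,…,a_r)`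
divides `n`, and `0` otherwise. -/
theorem card_congruent_tuples
    (r : ℕ) (hr : 1 ≤ r) (a : Fin r → ℕ) (ha : ∀ i, 0 < a i)
    (D : ℕ) (hD : 0 < D) (hdvd : ∀ i, a i ∣ D)
    (n : ℕ) :
    (Finset.univ.filter
        (fun j : ∀ i : Fin r, Fin (D / a i) => (∑ i, a i * (j i : ℕ)) % D = n % D)).card =
      if Finset.univ.gcd a ∣ n then
        Finset.univ.gcd a * D ^ (r - 1) / ∏ i, a i
      else 0 := by
  classical
  have hpos : ∀ i, NeZero (D / a i) := fun i =>
    ⟨(Nat.div_pos (Nat.le_of_dvd hD (hdvd i)) (ha i)).ne'⟩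
  have : NeZero D := ⟨hD.ne'⟩
  set g := Finset.univ.gcd a with hg
  have hgD : g ∣ D := (Finset.gcd_dvd (Finset.mem_univ ⟨0, hr⟩)).trans (hdvd _)
  set φ := ZMod.sumMulDivisorHom hdvd with hφ
  have hcard : (Finset.univ.filter
      (fun j : ∀ i : Fin r, Fin (D / a i) => (∑ i, a i * (j i : ℕ)) % D = n % D)).card =
      (Finset.univ.filter fun z => φ z = (n : ZMod D)).card := by
    refine Finset.card_equiv (Equiv.piCongrRight fun i => ZMod.finCastEquiv (D / a i)) fun j => ?_
    have hj : φ (Equiv.piCongrRight (fun i => ZMod.finCastEquiv (D / a i)) j) =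
        ((∑ i, a i * (j i : ℕ) : ℕ) : ZMod D) := by
      rw [hφ, ZMod.sumMulDivisorHom_apply, Nat.cast_sum]
      exact Finset.sum_congr rfl fun i _ => ZMod.mulDivisorHom_natCast (hdvd i) (j i)
    simp only [Finset.mem_filter, Finset.mem_univ, true_and]
    rw [hj, ZMod.natCast_eq_natCast_iff']
  have hrange : (n : ZMod D) ∈ φ.range ↔ g ∣ n := by
    rw [hφ, ZMod.range_sumMulDivisorHom, ZMod.natCast_mem_zmultiples_iff hgD]
  rw [hcard]
  split_ifs with hn
  · have hfib : (Finset.univ.filter fun z => φ z = (n : ZMod D)).card = Nat.card φ.ker := by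
      rw [AddMonoidHom.card_fiber_eq_of_mem_range φ (hrange.mpr hn) ⟨0, map_zero φ⟩,
        Nat.card_eq_fintype_card, Fintype.card_subtype]
      simp only [AddMonoidHom.mem_ker]
    have hker : Nat.card φ.ker * (D / g) = ∏ i, D / a i := by
      have hcardrange : Nat.card φ.range = D / g := by
        rw [hφ, ZMod.range_sumMulDivisorHom, Nat.card_zmultiples, ZMod.addOrderOf_coe _ hD.ne',
          Nat.gcd_eq_right hgD]
      rw [← hcardrange, ← AddSubgroup.index_ker, AddSubgroup.card_mul_index, Nat.card_pi]
      simp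
    have hprod : (∏ i, D / a i) * ∏ i, a i = D ^ r := by
      rw [← Finset.prod_mul_distrib]
      simp [Nat.div_mul_cancel (hdvd _)]
    rw [hfib]
    refine (Nat.div_eq_of_eq_mul_left (Finset.prod_pos fun i _ => ha i) ?_).symm
    refine Nat.eq_of_mul_eq_mul_right hD ?_
    calc g * D ^ (r - 1) * D = g * D ^ r := by
          rw [mul_assoc, ← pow_succ, Nat.sub_add_cancel hr]
      _ = Nat.card φ.ker * (∏ i, a i) * (D / g * g) := by
          rw [← hprod, ← hker]
          ring
      _ = Nat.card φ.ker * (∏ i, a i) * D := by rw [Nat.div_mul_cancel hgD]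
  · rw [Finset.card_eq_zero, Finset.filter_eq_empty_iff]
    exact fun z _ hz => hn (hrange.mp ⟨z, hz⟩)
end

section
/- For every n ≥ 0, p_a(n) = 0 if and only if n < a_1j_1+⋯+a_rj_r for every tuple (j_1,…,j_r) of integers with 0 ≤ j_1 ≤ D/a_1 − 1, …, 0 ≤ j_r ≤ D/a_r − 1 and a_1j_1+⋯+a_rj_r ≡ n (mod D). -/
theorem finite_setOf_sum_mul_eq {ι : Type*} [Fintype ι] (a : ι → ℕ) (ha : ∀ i, 0 < a i)
    (n : ℕ) : Finite {x : ι → ℕ // ∑ i, a i * x i = n} := by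
  refine Set.Finite.to_subtype (s := {x : ι → ℕ | ∑ i, a i * x i = n})
    ((Set.Finite.pi' fun _ => Set.finite_Iic n).subset ?_)
  rintro x rfl i
  exact (Nat.le_mul_of_pos_left _ (ha i)).trans
    (Finset.single_le_sum (f := fun i => a i * x i) (fun _ _ => Nat.zero_le _) (Finset.mem_univ i))

theorem restrictedPartition_eq_zero_iff_forall_ne {r : ℕ} {a : Fin r → ℕ} (ha : ∀ i, 0 < a i)
    (n : ℕ) : restrictedPartition r a n = 0 ↔ ∀ x : Fin r → ℕ, ∑ i, a i * x i ≠ n := by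
  have := finite_setOf_sum_mul_eq a ha n
  rw [restrictedPartition, Finite.card_eq_zero_iff, isEmpty_subtype]

/-- Corollary 1.12: `p_a(n) = 0` iff `n < a₁j₁+⋯+a_rj_r` for every tuple `(j₁,…,j_r)`
with `0 ≤ jᵢ ≤ D/aᵢ − 1` and `a₁j₁+⋯+a_rj_r ≡ n (mod D)`. -/
theorem restrictedPartition_eq_zero_iff
    (r : ℕ) (hr : 1 ≤ r) (a : Fin r → ℕ) (ha : ∀ i, 0 < a i)
    (D : ℕ) (hD : 0 < D) (hdvd : ∀ i, a i ∣ D)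
    (n : ℕ) :
    restrictedPartition r a n = 0 ↔
      ∀ j : ∀ i : Fin r, Fin (D / a i),
        (∑ i, a i * (j i : ℕ)) % D = n % D → n < ∑ i, a i * (j i : ℕ) := by
  rw [restrictedPartition_eq_zero_iff_forall_ne ha]
  constructor
  · intro h j hj
    by_contra! hle
    obtain ⟨k, hk⟩ := (Nat.modEq_iff_dvd' hle).1 hj
    let i₀ : Fin r := ⟨0, hr⟩
    refine h (fun i => j i + if i = i₀ then D / a i * k else 0) ?_
    simp only [mul_add, Finset.sum_add_distrib, mul_ite, mul_zero, Finset.sum_ite_eq',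
      Finset.mem_univ, if_true]
    rw [← mul_assoc, Nat.mul_div_cancel' (hdvd i₀), ← hk]
    omega
  · rintro h x rfl
    have hpos (i : Fin r) : 0 < D / a i := Nat.div_pos (Nat.le_of_dvd hD (hdvd i)) (ha i)
    refine (h (fun i => ⟨x i % (D / a i), Nat.mod_lt _ (hpos i)⟩) ?_).not_ge
      (Finset.sum_le_sum fun i _ => Nat.mul_le_mul_left _ (Nat.mod_le _ _))
    rw [Finset.sum_nat_mod, Finset.sum_nat_mod (f := fun i => a i * x i)]
    refine congrArg (· % D) (Finset.sum_congr rfl fun i _ => ?_)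
    rw [← Nat.mul_mod_mul_left, Nat.mul_div_cancel' (hdvd i), Nat.mod_mod]
end

section
/- (Popoviciu's formula) Let a_1, a_2 be positive integers with gcd(a_1,a_2) = 1 and let a = (a_1,a_2). For every n ≥ 0, p_a(n) = (n + a_1·a_1′(n) + a_2·a_2′(n))/(a_1a_2) − 1, where a_1′(n) is the unique integer with 1 ≤ a_1′(n) ≤ a_2 and a_1′(n)·a_1 ≡ −n (mod a_2), and a_2′(n) is the unique integer with 1 ≤ a_2′(n) ≤ a_1 and a_2′(n)·a_2 ≡ −n (mod a_1). -/
/-- The restricted partition function for a pair `(a₁,a₂)`: the number of pairs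
`(x₁,x₂)` of nonnegative integers with `a₁x₁ + a₂x₂ = n`. -/
noncomputable def restrictedPartitionPair (a₁ a₂ : ℕ) (n : ℕ) : ℕ :=
  Nat.card {x : ℕ × ℕ // a₁ * x.1 + a₂ * x.2 = n}

/-- If `n + a₁b₁ + a₂b₂ = a₁a₂m` with `1 ≤ b₁ ≤ a₂` and `1 ≤ b₂ ≤ a₁`, then the solutions of
`a₁x₁ + a₂x₂ = n` are the pairs `(a₂c - b₁, a₁d - b₂)` with `c, d ≥ 1` and `c + d = m`. -/
theorem restrictedPartitionPair_eq_sub_one {a₁ a₂ : ℕ} (h₁ : 0 < a₁) (h₂ : 0 < a₂)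
    (hco : Nat.Coprime a₁ a₂) {n b₁ b₂ m : ℕ} (hb₁ : 1 ≤ b₁) (hb₁' : b₁ ≤ a₂)
    (hb₂ : 1 ≤ b₂) (hb₂' : b₂ ≤ a₁) (hm : n + a₁ * b₁ + a₂ * b₂ = a₁ * a₂ * m) :
    restrictedPartitionPair a₁ a₂ n = m - 1 := by
  have key (i : Fin (m - 1)) :
      a₁ * (a₂ * (i + 1) - b₁) + a₂ * (a₁ * (m - 1 - i) - b₂) = n := by
    obtain ⟨k, hk⟩ : ∃ k, m = i + 1 + (k + 1) := ⟨m - i - 2, by omega⟩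
    have hk' : m - 1 - i = k + 1 := by omega
    rw [hk']
    obtain ⟨u, hu⟩ := Nat.exists_eq_add_of_le (hb₁'.trans (Nat.le_mul_of_pos_right a₂ i.1.succ_pos))
    obtain ⟨v, hv⟩ := Nat.exists_eq_add_of_le (hb₂'.trans (Nat.le_mul_of_pos_right a₁ k.succ_pos))
    simp only [Nat.succ_eq_add_one] at hu hv
    rw [hu, hv, Nat.add_sub_cancel_left, Nat.add_sub_cancel_left]
    rw [hk] at hm
    zify at hu hv hm ⊢
    linear_combination (-a₁ : ℤ) * hu - a₂ * hv - hm
  let f (i : Fin (m - 1)) : {x : ℕ × ℕ // a₁ * x.1 + a₂ * x.2 = n} :=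
    ⟨(a₂ * (i + 1) - b₁, a₁ * (m - 1 - i) - b₂), key i⟩
  have hf : Function.Bijective f := by
    constructor
    · intro i j hij
      have hfst : a₂ * (i + 1) - b₁ = a₂ * (j + 1) - b₁ := congrArg (fun x => x.1.1) hij
      have hi := hb₁'.trans (Nat.le_mul_of_pos_right a₂ i.1.succ_pos)
      have hj := hb₁'.trans (Nat.le_mul_of_pos_right a₂ j.1.succ_pos)
      have hmul := (tsub_left_inj hi hj).1 hfst
      have := Nat.eq_of_mul_eq_mul_left h₂ hmul
      exact Fin.ext (by omega)
    · rintro ⟨⟨x, y⟩, hxy⟩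
      simp only at hxy
      have hsum : a₁ * (x + b₁) + a₂ * (y + b₂) = a₁ * a₂ * m := by
        rw [← hm, ← hxy]; ring
      obtain ⟨c, hc⟩ : a₂ ∣ x + b₁ := by
        refine hco.symm.dvd_of_dvd_mul_left ((Nat.dvd_add_left (dvd_mul_right a₂ (y + b₂))).1 ?_)
        exact ⟨a₁ * m, by rw [hsum]; ring⟩
      obtain ⟨d, hd⟩ : a₁ ∣ y + b₂ := by
        refine hco.dvd_of_dvd_mul_left ((Nat.dvd_add_right (dvd_mul_right a₁ (x + b₁))).1 ?_)
        exact ⟨a₂ * m, by rw [hsum]; ring⟩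
      have hcd : c + d = m := by
        apply Nat.eq_of_mul_eq_mul_left (Nat.mul_pos h₁ h₂)
        rw [← hsum, hc, hd]; ring
      have hc0 : c ≠ 0 := by rintro rfl; omega
      have hd0 : d ≠ 0 := by rintro rfl; omega
      refine ⟨⟨c - 1, by omega⟩, Subtype.ext (Prod.ext ?_ ?_)⟩
      · change a₂ * (c - 1 + 1) - b₁ = x
        rw [Nat.sub_add_cancel (Nat.one_le_iff_ne_zero.2 hc0), ← hc, Nat.add_sub_cancel]
      · change a₁ * (m - 1 - (c - 1)) - b₂ = y
        rw [show m - 1 - (c - 1) = d by omega, ← hd, Nat.add_sub_cancel]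
  rw [restrictedPartitionPair, ← Nat.card_congr (Equiv.ofBijective f hf), Nat.card_fin]

/-- Corollary 1.13 (Popoviciu's formula): for coprime `a₁, a₂`,
`p_{(a₁,a₂)}(n) = (n + a₁a₁′(n) + a₂a₂′(n))/(a₁a₂) − 1`, where `a₁′(n)a₁ ≡ −n (mod a₂)`,
`1 ≤ a₁′(n) ≤ a₂`, and `a₂′(n)a₂ ≡ −n (mod a₁)`, `1 ≤ a₂′(n) ≤ a₁`. -/
theorem popoviciu_formula
    (a₁ a₂ : ℕ) (h₁ : 0 < a₁) (h₂ : 0 < a₂) (hco : Nat.Coprime a₁ a₂)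
    (n : ℕ) (a₁' a₂' : ℕ)
    (ha₁'₁ : 1 ≤ a₁') (ha₁'₂ : a₁' ≤ a₂)
    (ha₁' : ((a₁' : ℤ) * (a₁ : ℤ)) ≡ -(n : ℤ) [ZMOD (a₂ : ℤ)])
    (ha₂'₁ : 1 ≤ a₂') (ha₂'₂ : a₂' ≤ a₁)
    (ha₂' : ((a₂' : ℤ) * (a₂ : ℤ)) ≡ -(n : ℤ) [ZMOD (a₁ : ℤ)]) :
    (restrictedPartitionPair a₁ a₂ n : ℚ) =
      ((n : ℚ) + (a₁ : ℚ) * (a₁' : ℚ) + (a₂ : ℚ) * (a₂' : ℚ)) / ((a₁ : ℚ) * (a₂ : ℚ)) - 1 := by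
  obtain ⟨m, hm⟩ : a₁ * a₂ ∣ n + a₁ * a₁' + a₂ * a₂' := by
    refine hco.mul_dvd_of_dvd_of_dvd ?_ ?_
    · obtain ⟨k, hk⟩ := ha₂'.symm.dvd
      refine Int.natCast_dvd_natCast.1 ⟨k + a₁', ?_⟩
      push_cast
      linear_combination hk
    · obtain ⟨k, hk⟩ := ha₁'.symm.dvd
      refine Int.natCast_dvd_natCast.1 ⟨k + a₂', ?_⟩
      push_cast
      linear_combination hk
  have hm1 : 1 ≤ m := by
    rw [Nat.one_le_iff_ne_zero]
    rintro rfl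
    have := Nat.mul_pos h₁ ha₁'₁
    omega
  rw [restrictedPartitionPair_eq_sub_one h₁ h₂ hco ha₁'₁ ha₁'₂ ha₂'₁ ha₂'₂ hm, Nat.cast_sub hm1]
  have hmQ : (n : ℚ) + a₁ * a₁' + a₂ * a₂' = a₁ * a₂ * m := by exact_mod_cast hm
  rw [hmQ, mul_div_cancel_left₀ _ (by positivity), Nat.cast_one]
end

section
/- Let r ≥ 1 and D ≥ 1 be integers and let p : ℕ → ℂ be a quasi-polynomial of period D, i.e. p(n) = ∑_{m=0}^{r−1} d_m(n) n^m where each d_m : ℕ → ℂ satisfies d_m(n+D) = d_m(n) for all n. Then for every real w > 0 and every complex s with Re(s) > r, ∑_{n=0}^{∞} p(n)/(n+w)^s = (1/D^s) ∑_{m=0}^{r−1} ∑_{v=0}^{D−1} d_m(v) ∑_{k=0}^{m} C(m,k) (−w)^{m−k} D^{k} · ζ(s−k, (v+w)/D). -/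
theorem hasSum_hurwitzZetaSeries_s13 {a : ℝ} (ha : 0 < a) {t : ℂ} (ht : 1 < t.re) :
    HasSum (fun n : ℕ => ((n : ℂ) + (a : ℂ)) ^ (-t)) (hurwitzZetaSeries t (a : ℂ)) := by
  refine Summable.hasSum (Summable.of_norm ?_)
  refine ((Real.summable_one_div_nat_add_rpow a t.re).mpr ht).congr fun n => ?_
  have hn : 0 < (n : ℝ) + a := by positivity
  rw [← Complex.ofReal_natCast, ← Complex.ofReal_add, Complex.norm_cpow_eq_rpow_re_of_pos hn,
    abs_of_pos hn, Complex.neg_re, Real.rpow_neg hn.le, one_div]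

theorem hasSum_of_residue_classes {M : Type*} [AddCommMonoid M] [TopologicalSpace M]
    [ContinuousAdd M] {D : ℕ} (hD : 0 < D) {f S : ℕ → M}
    (h : ∀ v ∈ Finset.range D, HasSum (fun q => f (v + D * q)) (S v)) :
    HasSum f (∑ v ∈ Finset.range D, S v) := by
  have key : ∀ v ∈ Finset.range D, HasSum (fun n => if n % D = v then f n else 0) (S v) := by
    intro v hv
    have hinj : Function.Injective fun q : ℕ => v + D * q := fun x y hxy =>
      Nat.eq_of_mul_eq_mul_left hD (Nat.add_left_cancel hxy)
    refine (hinj.hasSum_iff fun n hn => if_neg fun hnv => hn ⟨n / D, ?_⟩).mp ?_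
    · rw [← hnv]
      exact Nat.mod_add_div n D
    · convert h v hv using 2 with q
      simp [Nat.mod_eq_of_lt (Finset.mem_range.mp hv)]
  convert hasSum_sum key using 2 with n
  rw [Finset.sum_ite_eq, if_pos (Finset.mem_range.mpr (Nat.mod_lt n hD))]

theorem pow_mul_cpow_scaled_shift {D : ℕ} {x w : ℝ} (hx : 0 < x) (m : ℕ) (s : ℂ) :
    ((D : ℂ) * x - w) ^ m * ((D : ℂ) * x) ^ (-s) =
      1 / (D : ℂ) ^ s * ∑ k ∈ Finset.range (m + 1),
        (m.choose k : ℂ) * (-(w : ℂ)) ^ (m - k) * (D : ℂ) ^ k * (x : ℂ) ^ (-(s - k)) := by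
  have hx0 : (x : ℂ) ≠ 0 := Complex.ofReal_ne_zero.mpr hx.ne'
  have hmul : ((D : ℂ) * x) ^ (-s) = 1 / (D : ℂ) ^ s * (x : ℂ) ^ (-s) := by
    rw [← Complex.ofReal_natCast, Complex.mul_cpow_ofReal_nonneg (Nat.cast_nonneg D) hx.le,
      Complex.cpow_neg (D : ℝ), one_div]
  rw [hmul, sub_eq_add_neg, add_pow, Finset.sum_mul, Finset.mul_sum]
  refine Finset.sum_congr rfl fun k _ => ?_
  rw [show -(s - k) = -s + (k : ℂ) by ring, Complex.cpow_add _ _ hx0, Complex.cpow_natCast, mul_pow]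
  ring

/-- Proposition 2.2: for a quasi-polynomial `p(n) = ∑_{m=0}^{r-1} d_m(n) nᵐ` with
`D`-periodic coefficients,
`∑_{n≥0} p(n)/(n+w)ˢ = (1/Dˢ) ∑_m ∑_v d_m(v) ∑_k C(m,k)(−w)^{m−k} Dᵏ ζ(s−k,(v+w)/D)`. -/
theorem quasipolynomial_zeta_decomposition
    (r D : ℕ) (hr : 1 ≤ r) (hD : 1 ≤ D)
    (p : ℕ → ℂ) (d : ℕ → ℕ → ℂ)
    (hper : ∀ m n, d m (n + D) = d m n)
    (hrep : ∀ n : ℕ, p n = ∑ m ∈ Finset.range r, d m n * (n : ℂ) ^ m)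
    (w : ℝ) (hw : 0 < w) (s : ℂ) (hs : (r : ℝ) < s.re) :
    (∑' n : ℕ, p n * ((n : ℂ) + (w : ℂ)) ^ (-s)) =
      1 / (D : ℂ) ^ s *
        ∑ m ∈ Finset.range r, ∑ v ∈ Finset.range D,
          d m v * ∑ k ∈ Finset.range (m + 1),
            (m.choose k : ℂ) * (-(w : ℂ)) ^ (m - k) * (D : ℂ) ^ k *
              hurwitzZetaSeries (s - (k : ℂ)) (((v : ℂ) + (w : ℂ)) / (D : ℂ)) := by
  have hD0 : (D : ℂ) ≠ 0 := Nat.cast_ne_zero.mpr (by omega)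
  have hper' : ∀ m v q, d m (v + D * q) = d m v := by
    intro m v q
    induction q with
    | zero => simp
    | succ q ih => rw [Nat.mul_succ, ← add_assoc, hper, ih]
  rw [Finset.sum_comm, Finset.mul_sum]
  refine (hasSum_of_residue_classes hD fun v _ => ?_).tsum_eq
  have ha : 0 < ((v : ℝ) + w) / D := by positivity
  have hterm : ∀ q : ℕ,
      p (v + D * q) * (((v + D * q : ℕ) : ℂ) + (w : ℂ)) ^ (-s) =
        1 / (D : ℂ) ^ s * ∑ m ∈ Finset.range r, d m v * ∑ k ∈ Finset.range (m + 1),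
          (m.choose k : ℂ) * (-(w : ℂ)) ^ (m - k) * (D : ℂ) ^ k *
            ((q : ℂ) + ((((v : ℝ) + w) / D : ℝ) : ℂ)) ^ (-(s - k)) := by
    intro q
    have hx : 0 < (q : ℝ) + ((v : ℝ) + w) / D := by positivity
    have hn : ((v + D * q : ℕ) : ℂ) + w = (D : ℂ) * (((q : ℝ) + ((v : ℝ) + w) / D : ℝ) : ℂ) := by
      push_cast
      field_simp
      ring
    rw [hrep, Finset.sum_mul, Finset.mul_sum]
    refine Finset.sum_congr rfl fun m _ => ?_
    have h := pow_mul_cpow_scaled_shift (D := D) (w := w) hx m s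
    rw [← hn, add_sub_cancel_right, Complex.ofReal_add, Complex.ofReal_natCast] at h
    rw [hper', mul_assoc, h]
    ring
  simp only [hterm]
  refine HasSum.mul_left _ (hasSum_sum fun m hm => HasSum.mul_left _ (hasSum_sum fun k hk =>
    HasSum.mul_left _ ?_))
  have hkr : (k : ℝ) + 1 ≤ r := by
    have := Finset.mem_range.mp hm
    have := Finset.mem_range.mp hk
    exact_mod_cast (by omega : k + 1 ≤ r)
  have hre : 1 < (s - k).re := by
    rw [Complex.sub_re, Complex.natCast_re]
    linarith
  simpa using hasSum_hurwitzZetaSeries_s13 ha hre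
end

section
/- For every integer t ≥ 0, α_t := ∑_{(j_1,…,j_r): 0 ≤ j_i ≤ D/a_i − 1 for all i} (a_1j_1+⋯+a_rj_r)^t satisfies α_t = t! · ∑_{i_1+⋯+i_r = t, i_1,…,i_r ≥ 0} ∑_{ℓ_1=0}^{i_1} ⋯ ∑_{ℓ_r=0}^{i_r} [ B_{ℓ_1} B_{ℓ_2} ⋯ B_{ℓ_r} / ( (i_1+1−ℓ_1)! ℓ_1! ⋯ (i_r+1−ℓ_r)! ℓ_r! ) ] · D^{t+r−ℓ_1−⋯−ℓ_r} · a_1^{ℓ_1−1} ⋯ a_r^{ℓ_r−1}, an identity in ℚ (note the exponents ℓ_i − 1 may equal −1). -/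
/-- The multinomial theorem in divided-power form. -/
theorem sum_pow_eq_factorial_mul_sum_antidiagonalTuple {K : Type*} [Field K] [CharZero K]
    {r : ℕ} (x : Fin r → K) (t : ℕ) :
    (∑ i, x i) ^ t = (t.factorial : K) *
      ∑ v ∈ Finset.Nat.antidiagonalTuple r t, ∏ i, x i ^ v i / ((v i).factorial : K) := by
  rw [Finset.sum_pow_eq_sum_piAntidiag, Finset.mul_sum]
  refine Finset.sum_congr ?_ fun v hv => ?_
  · ext v
    simp [Finset.Nat.mem_antidiagonalTuple]
  · have hs : ∑ i, v i = t := by simpa [Finset.Nat.mem_antidiagonalTuple] using hv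
    have h := Nat.multinomial_spec Finset.univ v
    rw [hs] at h
    have hne : (∏ i, ((v i).factorial : K)) ≠ 0 :=
      Finset.prod_ne_zero_iff.2 fun i _ => Nat.cast_ne_zero.2 (Nat.factorial_ne_zero _)
    rw [Finset.prod_div_distrib, ← h]
    push_cast
    field_simp

/-- Faulhaber's formula for the multiples of `a` below a multiple `D` of `a`. -/
theorem sum_multiples_pow_div_factorial {a D : ℕ} (ha : 0 < a) (hD : 0 < D) (h : a ∣ D) (m : ℕ) :
    (∑ j : Fin (D / a), ((a : ℚ) * (j : ℕ)) ^ m / (m.factorial : ℚ)) =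
      ∑ l ∈ Finset.range (m + 1),
        bernoulli l / (((m + 1 - l).factorial : ℚ) * (l.factorial : ℚ)) *
          (D : ℚ) ^ ((m : ℤ) + 1 - l) * (a : ℚ) ^ ((l : ℤ) - 1) := by
  obtain ⟨n, rfl⟩ := h
  have ha' : (a : ℚ) ≠ 0 := by positivity
  rw [Nat.mul_div_cancel_left n ha,
    Fin.sum_univ_eq_sum_range (fun j => ((a : ℚ) * (j : ℕ)) ^ m / (m.factorial : ℚ)) n]
  simp_rw [mul_pow, mul_div_assoc]
  rw [← Finset.mul_sum, ← Finset.sum_div, sum_range_pow, Finset.sum_div, Finset.mul_sum]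
  refine Finset.sum_congr rfl fun l hl => ?_
  have hlm : l ≤ m + 1 := by
    have := Finset.mem_range.1 hl
    omega
  obtain ⟨k, hk⟩ := Nat.exists_eq_add_of_le hlm
  have e1 : m + 1 - l = k := by omega
  have e2 : (m : ℤ) + 1 - l = (k : ℤ) := by omega
  have hpow : (a : ℚ) ^ k * (a : ℚ) ^ ((l : ℤ) - 1) = (a : ℚ) ^ m := by
    rw [← zpow_natCast, ← zpow_natCast, ← zpow_add₀ ha']
    congr 1
    omega
  have hfac : ((m : ℚ) + 1) * (m.factorial : ℚ) = ((m + 1).factorial : ℚ) := by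
    rw [Nat.factorial_succ]
    push_cast
    rfl
  have hf : ((m + 1).factorial : ℚ) ≠ 0 := Nat.cast_ne_zero.2 (Nat.factorial_ne_zero _)
  rw [e2, zpow_natCast, Nat.cast_choose ℚ hlm, e1, div_div _ _ (m.factorial : ℚ), hfac,
    Nat.cast_mul, mul_pow, ← hpow]
  field_simp


/-- Lemma 2.8: an explicit formula, via Bernoulli numbers, for the power sums
`α_t = ∑_j (a₁j₁+⋯+a_rj_r)ᵗ` over all tuples `j` with `0 ≤ jᵢ ≤ D/aᵢ − 1`. -/
theorem power_sum_bernoulli_formula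
    (r : ℕ) (hr : 1 ≤ r) (a : Fin r → ℕ) (ha : ∀ i, 0 < a i)
    (D : ℕ) (hD : 0 < D) (hdvd : ∀ i, a i ∣ D)
    (t : ℕ) :
    (∑ j : ∀ i : Fin r, Fin (D / a i), ((∑ i, a i * (j i : ℕ) : ℕ) : ℚ) ^ t) =
      (Nat.factorial t : ℚ) *
        ∑ iv ∈ Finset.Nat.antidiagonalTuple r t,
          ∑ l ∈ Fintype.piFinset (fun x : Fin r => Finset.range (iv x + 1)),
            (∏ x, bernoulli (l x)) /
                (∏ x, ((Nat.factorial (iv x + 1 - l x) : ℚ) * (Nat.factorial (l x) : ℚ))) *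
              (D : ℚ) ^ (((t : ℤ) + (r : ℤ)) - ∑ x, (l x : ℤ)) *
              ∏ x, (a x : ℚ) ^ ((l x : ℤ) - 1) := by
  have hD' : (D : ℚ) ≠ 0 := by positivity
  push_cast
  simp_rw [sum_pow_eq_factorial_mul_sum_antidiagonalTuple]
  rw [← Finset.mul_sum, Finset.sum_comm]
  congr 1
  refine Finset.sum_congr rfl fun v hv => ?_
  have hs : ∑ i, v i = t := Finset.Nat.mem_antidiagonalTuple.1 hv
  rw [← Fintype.piFinset_univ, ← Finset.prod_univ_sum (fun _ => Finset.univ)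
    (fun i (j : Fin (D / a i)) => ((a i : ℚ) * (j : ℕ)) ^ v i / ((v i).factorial : ℚ)),
    Finset.prod_congr rfl fun i _ => sum_multiples_pow_div_factorial (ha i) hD (hdvd i) (v i),
    Finset.prod_univ_sum]
  refine Finset.sum_congr rfl fun l _ => ?_
  have hexp : (t : ℤ) + r - ∑ x, (l x : ℤ) = ∑ x, ((v x : ℤ) + 1 - l x) := by
    rw [← hs]
    simp [Finset.sum_add_distrib]
  have hpow : ∏ x, (D : ℚ) ^ ((v x : ℤ) + 1 - l x) = (D : ℚ) ^ ∑ x, ((v x : ℤ) + 1 - l x) := by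
    induction (Finset.univ : Finset (Fin r)) using Finset.induction_on with
    | empty => simp
    | insert i s hi ih => rw [Finset.prod_insert hi, Finset.sum_insert hi, zpow_add₀ hD', ih]
  rw [hexp, ← hpow, Finset.prod_mul_distrib, Finset.prod_mul_distrib, Finset.prod_div_distrib]
end

section
/- Let r ≥ 2 and 0 ≤ j ≤ r−2 be integers, and let Q(x) := (x+1)(x+2)⋯(x+r−1). Then ∫_{[0,1]^r} Q^{(j)}(−t_1−⋯−t_r) dt_1⋯dt_r = 0, where Q^{(j)} denotes the j-th derivative of the polynomial Q. -/
open MeasureTheory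
open Polynomial

/-- Differentiation is surjective on real polynomials. -/
theorem range_derivative_eq_top :
    LinearMap.range (derivative : ℝ[X] →ₗ[ℝ] ℝ[X]) = ⊤ := by
  refine eq_top_iff.2 fun p _ => ?_
  induction p using Polynomial.induction_on' with
  | add p q hp hq => exact add_mem (hp trivial) (hq trivial)
  | monomial n a =>
    refine ⟨monomial (n + 1) (a / (n + 1)), ?_⟩
    have : (n : ℝ) + 1 ≠ 0 := by positivity
    rw [derivative_monomial]
    simp [this]

theorem exists_derivative_eq (p : ℝ[X]) : ∃ q : ℝ[X], derivative q = p :=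
  LinearMap.range_eq_top.1 range_derivative_eq_top p

/-- A linear choice of antiderivative for real polynomials. -/
noncomputable def antiderivative : ℝ[X] →ₗ[ℝ] ℝ[X] :=
  (LinearMap.exists_rightInverse_of_surjective _ range_derivative_eq_top).choose

theorem derivative_antiderivative (p : ℝ[X]) : derivative (antiderivative p) = p :=
  LinearMap.congr_fun
    (LinearMap.exists_rightInverse_of_surjective _ range_derivative_eq_top).choose_spec p

/-- The operator sending `p` to the polynomial `x ↦ ∫ t in 0..1, p (x - t)`. -/
noncomputable def unitAverage : Module.End ℝ ℝ[X] :=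
  (LinearMap.id - taylor (-1)) ∘ₗ antiderivative

theorem unitAverage_derivative (p : ℝ[X]) :
    unitAverage (derivative p) = p - taylor (-1) p := by
  obtain ⟨c, hc⟩ : ∃ c : ℝ, antiderivative (derivative p) = p + C c := by
    refine ⟨(antiderivative (derivative p) - p).coeff 0, ?_⟩
    rw [← eq_C_of_derivative_eq_zero (p := antiderivative (derivative p) - p)]
    · ring
    · rw [derivative_sub, derivative_antiderivative, sub_self]
  simp [unitAverage, hc]

theorem derivative_taylor_neg_one (p : ℝ[X]) :
    derivative (taylor (-1) p) = taylor (-1) (derivative p) := by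
  simp [taylor_apply, derivative_comp]

theorem unitAverage_derivative_comm (p : ℝ[X]) :
    unitAverage (derivative p) = derivative (unitAverage p) := by
  obtain ⟨q, rfl⟩ := exists_derivative_eq p
  simp [unitAverage_derivative, derivative_taylor_neg_one]

theorem unitAverage_pow_iterate_derivative (n j : ℕ) (p : ℝ[X]) :
    (unitAverage ^ n) (derivative^[j] p) = derivative^[j] ((unitAverage ^ n) p) := by
  have h : Function.Commute (unitAverage : ℝ[X] → ℝ[X]) derivative :=
    unitAverage_derivative_comm
  rw [Module.End.pow_apply, Module.End.pow_apply]
  exact (h.iterate_iterate n j) p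

/-- The commutator of `unitAverage` with multiplication by `X`. -/
noncomputable def unitAverageCommutator : Module.End ℝ ℝ[X] :=
  unitAverage * LinearMap.mulLeft ℝ X - LinearMap.mulLeft ℝ X * unitAverage

theorem unitAverageCommutator_apply (p : ℝ[X]) :
    unitAverageCommutator p = unitAverage (X * p) - X * unitAverage p := rfl

theorem unitAverageCommutator_derivative (p : ℝ[X]) :
    unitAverageCommutator (derivative p) = taylor (-1) p - unitAverage p := by
  have h : X * derivative p = derivative (X * p) - p := by
    rw [derivative_mul, derivative_X]; ring
  rw [unitAverageCommutator_apply, h, map_sub, unitAverage_derivative, unitAverage_derivative,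
    taylor_mul, taylor_X]
  simp only [map_neg, map_one]
  ring

theorem commute_unitAverage_unitAverageCommutator :
    Commute unitAverage unitAverageCommutator := by
  refine LinearMap.ext fun p => ?_
  obtain ⟨q, rfl⟩ := exists_derivative_eq p
  obtain ⟨q, rfl⟩ := exists_derivative_eq q
  simp only [Module.End.mul_apply, unitAverageCommutator_derivative, unitAverage_derivative,
    map_sub, ← derivative_taylor_neg_one]
  ring

theorem unitAverage_pow_succ_X_mul (n : ℕ) (p : ℝ[X]) :
    (unitAverage ^ (n + 1)) (X * p) = X * (unitAverage ^ (n + 1)) p +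
      ((n : ℝ[X]) + 1) * unitAverageCommutator ((unitAverage ^ n) p) := by
  have comm (k : ℕ) (q : ℝ[X]) : (unitAverage ^ k) (unitAverageCommutator q) =
      unitAverageCommutator ((unitAverage ^ k) q) :=
    LinearMap.congr_fun (commute_unitAverage_unitAverageCommutator.pow_left k) q
  induction n generalizing p with
  | zero => simp [unitAverageCommutator_apply]
  | succ n ih =>
    have h : unitAverage (X * p) = X * unitAverage p + unitAverageCommutator p := by
      rw [unitAverageCommutator_apply]; ring
    rw [pow_succ, Module.End.mul_apply, Module.End.mul_apply, h, map_add, ih, comm,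
      ← Module.End.mul_apply (unitAverage ^ n), ← pow_succ]
    push_cast
    ring

theorem succ_mul_unitAverage_X_pow (n : ℕ) :
    ((n : ℝ[X]) + 1) * unitAverage (X ^ n) = X ^ (n + 1) - (X - 1) ^ (n + 1) := by
  have h := unitAverage_derivative (X ^ (n + 1))
  rw [derivative_X_pow, taylor_apply, X_pow_comp, ← smul_eq_C_mul, map_smul, smul_eq_C_mul] at h
  simpa [sub_eq_add_neg] using h

/-- Averaging `(x+1)⋯(x+n)` over `n + 1` unit intervals gives `x ^ n`. -/
theorem unitAverage_pow_prod_X_add_C (n : ℕ) :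
    (unitAverage ^ (n + 1)) (∏ i ∈ Finset.range n, (X + C ((i : ℝ) + 1))) = X ^ n := by
  induction n with
  | zero => simpa using succ_mul_unitAverage_X_pow 0
  | succ n ih =>
    have h : ∏ i ∈ Finset.range (n + 1), (X + C ((i : ℝ) + 1)) =
        X * ∏ i ∈ Finset.range n, (X + C ((i : ℝ) + 1)) +
          ((n : ℝ) + 1) • ∏ i ∈ Finset.range n, (X + C ((i : ℝ) + 1)) := by
      rw [Finset.prod_range_succ, smul_eq_C_mul]; ring
    rw [h, map_add, map_smul, unitAverage_pow_succ_X_mul, ih, pow_succ', Module.End.mul_apply, ih,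
      unitAverageCommutator_apply, ← pow_succ', smul_eq_C_mul]
    have h₀ := succ_mul_unitAverage_X_pow n
    have h₁ := succ_mul_unitAverage_X_pow (n + 1)
    push_cast at h₁ ⊢
    simp only [map_add, map_one, map_natCast]
    linear_combination h₁ + (1 - X) * h₀

theorem setIntegral_Icc_eval_sub (p : ℝ[X]) (x : ℝ) :
    ∫ t in Set.Icc (0 : ℝ) 1, p.eval (x - t) = (unitAverage p).eval x := by
  obtain ⟨q, rfl⟩ := exists_derivative_eq p
  rw [integral_Icc_eq_integral_Ioc, ← intervalIntegral.integral_of_le zero_le_one,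
    intervalIntegral.integral_comp_sub_left (fun y => (derivative q).eval y),
    intervalIntegral.integral_eq_sub_of_hasDerivAt (fun y _ => q.hasDerivAt y)
      ((derivative q).continuous.intervalIntegrable _ _),
    unitAverage_derivative]
  simp [taylor_apply, sub_eq_add_neg]

/-- Integrating `p (x - t₁ - ⋯ - tₙ)` over the unit cube amounts to averaging `n` times. -/
theorem setIntegral_cube_eval_sub_sum (n : ℕ) (p : ℝ[X]) (x : ℝ) :
    ∫ t : Fin n → ℝ in Set.univ.pi fun _ : Fin n => Set.Icc (0 : ℝ) 1,
      p.eval (x - ∑ i, t i) = ((unitAverage ^ n) p).eval x := by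
  induction n generalizing x with
  | zero =>
    rw [volume_pi, Measure.restrict_pi_pi, Measure.pi_of_empty, integral_dirac]
    simp
  | succ n ih =>
    have hint : Integrable (fun z : ℝ × (Fin n → ℝ) => p.eval (x - (z.1 + ∑ i, z.2 i)))
        ((volume.restrict (Set.Icc (0 : ℝ) 1)).prod
          (Measure.pi fun _ : Fin n => volume.restrict (Set.Icc (0 : ℝ) 1))) := by
      rw [← Measure.restrict_pi_pi, Measure.prod_restrict]
      refine ContinuousOn.integrableOn_compact
        (isCompact_Icc.prod (isCompact_univ_pi fun _ => isCompact_Icc)) ?_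
      exact (p.continuous.comp (by fun_prop)).continuousOn
    have hmp := measurePreserving_piFinSuccAbove
      (fun _ : Fin (n + 1) => (volume : Measure ℝ).restrict (Set.Icc (0 : ℝ) 1)) 0
    have hcomp := hmp.integral_comp' fun z => p.eval (x - (z.1 + ∑ i, z.2 i))
    rw [integral_prod _ hint] at hcomp
    rw [volume_pi, Measure.restrict_pi_pi, pow_succ', Module.End.mul_apply,
      ← setIntegral_Icc_eval_sub]
    simp_rw [← ih, volume_pi, Measure.restrict_pi_pi, sub_sub, ← hcomp]
    simp [Fin.sum_univ_succ, MeasurableEquiv.piFinSuccAbove, Fin.tail]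

/-- Lemma 2.9: for `r ≥ 2`, `0 ≤ j ≤ r−2`, and `Q(x) = (x+1)(x+2)⋯(x+r−1)`,
the integral of `Q^{(j)}(−t₁−⋯−t_r)` over the unit cube `[0,1]^r` vanishes. -/
theorem integral_derivative_risingFactorial_eq_zero
    (r : ℕ) (hr : 2 ≤ r) (j : ℕ) (hj : j ≤ r - 2)
    (Q : Polynomial ℝ)
    (hQ : Q = ∏ i ∈ Finset.range (r - 1), (Polynomial.X + Polynomial.C ((i : ℝ) + 1))) :
    (∫ t : Fin r → ℝ in Set.univ.pi fun _ : Fin r => Set.Icc (0 : ℝ) 1,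
      (Polynomial.derivative^[j] Q).eval (-(∑ i, t i))) = 0 := by
  obtain ⟨n, rfl⟩ : ∃ n, r = n + 1 := ⟨r - 1, by omega⟩
  have h := setIntegral_cube_eval_sub_sum (n + 1) (derivative^[j] Q) 0
  simp only [zero_sub] at h
  rw [h, unitAverage_pow_iterate_derivative, hQ, Nat.add_sub_cancel,
    unitAverage_pow_prod_X_add_C, iterate_derivative_X_pow_eq_smul]
  have hn : n - j ≠ 0 := by omega
  simp [hn]
end

section
/- Suppose polynomials P_λ ∈ ℂ[X], one for each complex λ with λ^D = 1, satisfy p_a(n) = ∑_{λ: λ^D = 1} P_λ(n) λ^{−n} for all n ≥ 0. Then the polynomial part P_a := P_1 satisfies, as polynomials in n, P_a(n) = (1/(a_1⋯a_r)) ∑_{u=0}^{r−1} ((−1)^u/(r−1−u)!) ∑_{i_1+⋯+i_r = u, i_1,…,i_r ≥ 0} ( B_{i_1} ⋯ B_{i_r} / (i_1! ⋯ i_r!) ) a_1^{i_1} ⋯ a_r^{i_r} · n^{r−1−u}. -/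
open PowerSeries in
/-- The formal exponential series `e^{cX}`. -/
noncomputable def expSeries (c : ℂ) : PowerSeries ℂ := rescale c (exp ℂ)

open PowerSeries in
/-- The Todd series `dX / (1 - e^{-dX})`. -/
noncomputable def toddSeries (d : ℂ) : PowerSeries ℂ := rescale (-d) (bernoulliPowerSeries ℂ)

open PowerSeries in
/-- The polynomial in `x` given by the coefficient of `X ^ s` in `e^{xX} * F`. -/
noncomputable def expCoeffPolynomial (s : ℕ) : PowerSeries ℂ →ₗ[ℂ] Polynomial ℂ :=
  ∑ u ∈ Finset.range (s + 1),
    Polynomial.monomial (s - u) ∘ₗ (((Nat.factorial (s - u) : ℂ)⁻¹) • coeff u)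

namespace PowerSeries

lemma coeff_expSeries (c : ℂ) (n : ℕ) :
    coeff n (expSeries c) = c ^ n * (Nat.factorial n : ℂ)⁻¹ := by
  simp [expSeries, coeff_rescale, coeff_exp]

lemma expSeries_add (c d : ℂ) : expSeries (c + d) = expSeries c * expSeries d :=
  (exp_mul_exp_eq_exp_add c d).symm

lemma expSeries_zero : expSeries 0 = 1 := by simp [expSeries]

lemma expSeries_nat_mul (n : ℕ) (c : ℂ) : expSeries (n * c) = expSeries c ^ n := by
  induction n with
  | zero => simp [expSeries_zero]
  | succ n ih => rw [Nat.cast_succ, add_mul, one_mul, expSeries_add, ih, pow_succ]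

lemma expSeries_sum {ι : Type*} (s : Finset ι) (c : ι → ℂ) :
    expSeries (∑ i ∈ s, c i) = ∏ i ∈ s, expSeries (c i) := by
  classical
  induction s using Finset.induction_on with
  | empty => simp [expSeries_zero]
  | insert i s hi ih => rw [Finset.sum_insert hi, Finset.prod_insert hi, expSeries_add, ih]

lemma derivative_expSeries (c : ℂ) : derivative ℂ (expSeries c) = c • expSeries c := by
  ext n
  have : (n : ℂ) + 1 ≠ 0 := by exact_mod_cast n.succ_ne_zero
  rw [coeff_derivative, coeff_smul, coeff_expSeries, coeff_expSeries, Nat.factorial_succ]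
  push_cast
  rw [smul_eq_mul]
  field_simp
  ring

lemma coeff_toddSeries (d : ℂ) (n : ℕ) :
    coeff n (toddSeries d) =
      (-1) ^ n * (((bernoulli n : ℚ) : ℂ) / (Nat.factorial n : ℂ) * d ^ n) := by
  rw [toddSeries, coeff_rescale, bernoulliPowerSeries, coeff_mk, neg_pow]
  simp
  ring

lemma toddSeries_mul_one_sub (d : ℂ) : toddSeries d * (1 - expSeries (-d)) = d • X := by
  have h := congrArg (rescale (-d)) (bernoulliPowerSeries_mul_exp_sub_one ℂ)
  rw [map_mul, map_sub, map_one, rescale_X] at h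
  rw [toddSeries, expSeries, ← neg_sub, mul_neg, h, map_neg, neg_mul, neg_neg, smul_eq_C_mul]

lemma smul_X_ne_zero {d : ℂ} (hd : d ≠ 0) : d • (X : PowerSeries ℂ) ≠ 0 :=
  smul_ne_zero hd X_ne_zero

lemma one_sub_expSeries_ne_zero {d : ℂ} (hd : d ≠ 0) : 1 - expSeries (-d) ≠ 0 := fun h =>
  smul_X_ne_zero hd (by rw [← toddSeries_mul_one_sub, h, mul_zero])

lemma X_mul_derivative_toddSeries {d : ℂ} (hd : d ≠ 0) :
    X * derivative ℂ (toddSeries d) + toddSeries d ^ 2 * expSeries (-d) = toddSeries d := by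
  have h := toddSeries_mul_one_sub d
  have h' := congrArg (derivative ℂ) h
  rw [Derivation.leibniz, map_sub, Derivation.map_one_eq_zero, derivative_expSeries,
    Derivation.map_smul, derivative_X] at h'
  simp only [smul_eq_mul, smul_eq_C_mul, map_neg] at h h'
  have hC : (C d : PowerSeries ℂ) ≠ 0 := by simpa using hd
  apply mul_left_cancel₀ hC
  linear_combination toddSeries d * h' - derivative ℂ (toddSeries d) * h

lemma coeff_toddSeries_pow_mul_expSeries_neg {d : ℂ} (hd : d ≠ 0) (s : ℕ) :
    coeff (s + 1) (expSeries (-d) * toddSeries d ^ (s + 2)) = 0 := by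
  set f := toddSeries d
  have h : ((s : PowerSeries ℂ) + 1) * (expSeries (-d) * f ^ (s + 2)) =
      ((s : PowerSeries ℂ) + 1) * f ^ (s + 1) - X * derivative ℂ (f ^ (s + 1)) := by
    rw [derivative_pow]
    push_cast
    linear_combination ((s : PowerSeries ℂ) + 1) * f ^ s * X_mul_derivative_toddSeries hd
  have hs : (s : PowerSeries ℂ) + 1 = C ((s : ℂ) + 1) := by simp
  have h' := congrArg (coeff (s + 1)) h
  rw [hs, map_sub, coeff_C_mul, coeff_C_mul, coeff_succ_X_mul, coeff_derivative,
    mul_comm (coeff _ _), sub_self] at h'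
  exact (mul_eq_zero.1 h').resolve_left (by exact_mod_cast s.succ_ne_zero)

lemma coeff_expSeries_mul_toddSeries_pow_sub (d c : ℂ) (s : ℕ) :
    coeff (s + 1) (expSeries (c + d) * toddSeries d ^ (s + 2)) =
      coeff (s + 1) (expSeries c * toddSeries d ^ (s + 2)) +
        d * coeff s (expSeries (c + d) * toddSeries d ^ (s + 1)) := by
  have hc : expSeries c = expSeries (c + d) * expSeries (-d) := by
    rw [← expSeries_add, add_neg_cancel_right]
  have h : expSeries (c + d) * toddSeries d ^ (s + 2) =
      expSeries c * toddSeries d ^ (s + 2) +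
        d • (X * (expSeries (c + d) * toddSeries d ^ (s + 1))) := by
    have := toddSeries_mul_one_sub d
    rw [hc]
    simp only [smul_eq_C_mul] at this ⊢
    linear_combination expSeries (c + d) * toddSeries d ^ (s + 1) * this
  rw [h, map_add, coeff_smul, coeff_succ_X_mul, smul_eq_mul]

lemma constantCoeff_toddSeries (d : ℂ) : constantCoeff (toddSeries d) = 1 := by
  rw [← coeff_zero_eq_constantCoeff_apply, coeff_toddSeries]
  simp

lemma coeff_expSeries_mul_toddSeries_pow {d : ℂ} (hd : d ≠ 0) (s m : ℕ) :
    coeff s (expSeries (m * d) * toddSeries d ^ (s + 1)) =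
      d ^ s * (Nat.multichoose (s + 1) m : ℂ) := by
  induction s generalizing m with
  | zero =>
    simp [constantCoeff_toddSeries, ← coeff_zero_eq_constantCoeff_apply (expSeries _),
      coeff_expSeries]
  | succ s ih =>
    induction m with
    | zero =>
      have h := coeff_expSeries_mul_toddSeries_pow_sub d (-d) s
      have h0 := ih 0
      simp only [Nat.cast_zero, zero_mul, Nat.multichoose_zero_right, neg_add_cancel,
        coeff_toddSeries_pow_mul_expSeries_neg hd] at h h0 ⊢
      rw [h, h0, pow_succ]
      ring
    | succ m ihm =>
      have h := coeff_expSeries_mul_toddSeries_pow_sub d (m * d) s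
      have hm : (m : ℂ) * d + d = (m + 1 : ℕ) * d := by push_cast; ring
      rw [hm] at h
      rw [h, ihm, ih, Nat.multichoose_succ_succ (s + 1)]
      push_cast
      ring

lemma sum_expSeries_mul_toddSeries {b : ℂ} (hb : b ≠ 0) (q : ℕ) :
    (∑ j : Fin q, expSeries (-(b * (j : ℕ)))) * toddSeries (q * b) = (q : ℂ) • toddSeries b := by
  have hsum : (∑ j : Fin q, expSeries (-(b * (j : ℕ)))) =
      ∑ j ∈ Finset.range q, expSeries (-b) ^ j := by
    rw [Finset.sum_range]
    refine Finset.sum_congr rfl fun j _ => ?_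
    rw [← expSeries_nat_mul]
    congr 1
    ring
  apply mul_right_cancel₀ (one_sub_expSeries_ne_zero hb)
  have h := toddSeries_mul_one_sub b
  have h' := toddSeries_mul_one_sub (q * b)
  rw [← mul_neg, expSeries_nat_mul, ← geom_sum_mul_neg] at h'
  rw [hsum, smul_mul_assoc, h, smul_smul, ← h']
  ring

lemma eval_expCoeffPolynomial (s : ℕ) (F : PowerSeries ℂ) (x : ℂ) :
    (expCoeffPolynomial s F).eval x = coeff s (expSeries x * F) := by
  rw [mul_comm, coeff_mul, Finset.Nat.sum_antidiagonal_eq_sum_range_succ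
    (fun i j => coeff i F * coeff j (expSeries x))]
  simp only [expCoeffPolynomial, LinearMap.sum_apply, Polynomial.eval_finsetSum,
    LinearMap.comp_apply, LinearMap.smul_apply, Polynomial.eval_monomial, coeff_expSeries,
    smul_eq_mul]
  exact Finset.sum_congr rfl fun u _ => by ring

lemma coeff_prod_toddSeries {r : ℕ} (a : Fin r → ℂ) (u : ℕ) :
    coeff u (∏ i, toddSeries (a i)) = (-1) ^ u * ∑ iv ∈ Finset.Nat.antidiagonalTuple r u,
      ((∏ x, ((bernoulli (iv x) : ℚ) : ℂ)) / ∏ x, (Nat.factorial (iv x) : ℂ)) *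
        ∏ x, a x ^ (iv x) := by
  rw [coeff_prod, Finset.mul_sum]
  refine Finset.sum_bij (fun l _ => ⇑l) ?_ ?_ ?_ ?_
  · intro l hl
    simpa [Finset.Nat.mem_antidiagonalTuple] using hl
  · intro l _ l' _ h
    exact DFunLike.coe_injective h
  · intro l hl
    refine ⟨Finsupp.equivFunOnFinite.symm l, ?_, by simp⟩
    simpa [Finset.Nat.mem_antidiagonalTuple] using hl
  · intro l hl
    have hl' : ∑ i, l i = u := by simpa using hl
    simp only [coeff_toddSeries]
    rw [Finset.prod_mul_distrib, Finset.prod_mul_distrib, Finset.prod_div_distrib,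
      Finset.prod_pow_eq_pow_sum, hl']

end PowerSeries

lemma Nat.card_subtype_sum_eq (r m : ℕ) :
    Nat.card {x : Fin r → ℕ // ∑ i, x i = m} = Nat.multichoose r m := by
  have h : Nat.card {x : Fin r → ℕ // ∑ i, x i = m} =
      (Finset.piAntidiag (Finset.univ : Finset (Fin r)) m).card := by
    rw [← Nat.card_eq_finsetCard]
    exact Nat.card_congr (Equiv.subtypeEquivRight fun x => by simp)
  rw [h, ← Finset.map_sym_eq_piAntidiag, Finset.card_map, Finset.sym_univ, Finset.card_univ,
    Sym.card_sym_eq_multichoose, Fintype.card_fin]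

lemma Nat.finite_subtype_sum_eq (r m : ℕ) : Finite {x : Fin r → ℕ // ∑ i, x i = m} :=
  Finite.of_injective (β := (Finset.piAntidiag (Finset.univ : Finset (Fin r)) m))
    (fun x => ⟨x.1, by simpa using x.2⟩) fun x y h => Subtype.ext (Subtype.mk.inj h)

/-- Counting solutions according to the residues of `x i` modulo `q i`. -/
lemma restrictedPartition_eq_sum_s19 {r : ℕ} {a q : Fin r → ℕ} {D : ℕ} (hD : 0 < D)
    (hq : ∀ i, a i * q i = D) {n : ℕ} (hn : ∑ i, a i * q i ≤ n) :
    restrictedPartition r a n = ∑ k : ∀ i, Fin (q i),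
      if (∑ i, a i * (k i : ℕ)) % D = n % D then
        Nat.multichoose r ((n - ∑ i, a i * (k i : ℕ)) / D) else 0 := by
  have hq0 : ∀ i, NeZero (q i) := fun i => ⟨fun h => by have := hq i; simp [h] at this; omega⟩
  let e : (Fin r → ℕ) ≃ (∀ i, Fin (q i)) × (Fin r → ℕ) :=
    (Equiv.piCongrRight fun i => (Nat.divModEquiv (q i)).trans (Equiv.prodComm _ _)).trans
      (Equiv.arrowProdEquivProdArrow _ _ _)
  have he : ∀ x, ∑ i, a i * x i =
      ∑ i, a i * ((e x).1 i : ℕ) + D * ∑ i, (e x).2 i := by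
    intro x
    rw [Finset.mul_sum, ← Finset.sum_add_distrib]
    refine Finset.sum_congr rfl fun i _ => ?_
    change a i * x i = a i * (x i % q i) + D * (x i / q i)
    rw [← hq i, mul_assoc, ← mul_add, Nat.mod_add_div]
  have hle : ∀ k : ∀ i, Fin (q i), ∑ i, a i * (k i : ℕ) ≤ n := fun k =>
    (Finset.sum_le_sum fun i _ => Nat.mul_le_mul_left _ (k i).2.le).trans hn
  have hiff : ∀ (k : ∀ i, Fin (q i)) (M : ℕ), ∑ i, a i * (k i : ℕ) + D * M = n ↔
      (∑ i, a i * (k i : ℕ)) % D = n % D ∧ M = (n - ∑ i, a i * (k i : ℕ)) / D := by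
    intro k M
    constructor
    · rintro h
      rw [← h]
      refine ⟨(Nat.add_mul_mod_self_left _ _ _).symm, ?_⟩
      rw [Nat.add_sub_cancel_left, Nat.mul_div_cancel_left _ hD]
    · rintro ⟨h, rfl⟩
      rw [Nat.mul_div_cancel' ((Nat.modEq_iff_dvd' (hle k)).1 h), Nat.add_sub_cancel' (hle k)]
  have hfin : ∀ k : ∀ i, Fin (q i),
      Finite {m : Fin r → ℕ // ∑ i, a i * (k i : ℕ) + D * ∑ i, m i = n} := fun k =>
    have := Nat.finite_subtype_sum_eq r ((n - ∑ i, a i * (k i : ℕ)) / D)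
    Finite.of_injective (β := {x : Fin r → ℕ // ∑ i, x i = (n - ∑ i, a i * (k i : ℕ)) / D})
      (fun x => ⟨x.1, ((hiff k _).1 x.2).2⟩) fun x y h => Subtype.ext (Subtype.mk.inj h)
  rw [restrictedPartition, Nat.card_congr ((e.subtypeEquiv
    (q := fun p => ∑ i, a i * (p.1 i : ℕ) + D * ∑ i, p.2 i = n) fun x => by rw [he]).trans
      (Equiv.subtypeProdEquivSigmaSubtype
        fun (k : ∀ i, Fin (q i)) (m : Fin r → ℕ) => ∑ i, a i * (k i : ℕ) + D * ∑ i, m i = n)),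
    Nat.card_sigma]
  refine Finset.sum_congr rfl fun k _ => ?_
  split_ifs with h
  · rw [← Nat.card_subtype_sum_eq]
    exact Nat.card_congr (Equiv.subtypeEquivRight fun m => by rw [hiff, and_iff_right h])
  · rw [Nat.card_eq_zero]
    exact Or.inl ⟨fun m => h ((hiff k _).1 m.2).1⟩

lemma sum_zpow_neg_nthRoots {D : ℕ} {l : ℂ} (hl : l ^ D = 1) :
    ∑ c ∈ Finset.range D, l ^ (-(c : ℤ)) = if l = 1 then (D : ℂ) else 0 := by
  split_ifs with h
  · simp [h]
  · have h1 : l⁻¹ - 1 ≠ 0 := sub_ne_zero.2 fun h' => h (inv_eq_one.1 h')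
    apply mul_right_cancel₀ h1
    simp only [zpow_neg, zpow_natCast, ← inv_pow]
    rw [geom_sum_mul, inv_pow, hl]
    simp

open PowerSeries in
/-- Polynomials representing a quasi-polynomial on a residue class modulo `D`. -/
lemma sum_C_mul_eq_of_restrictedPartition {s : ℕ} {a q : Fin (s + 1) → ℕ} {D : ℕ} (hD : 0 < D)
    (hq : ∀ i, a i * q i = D) (P : ℂ → Polynomial ℂ)
    (hP : ∀ n : ℕ, (restrictedPartition (s + 1) a n : ℂ) =
      ∑ l ∈ (Polynomial.nthRoots D (1 : ℂ)).toFinset, (P l).eval (n : ℂ) * l ^ (-(n : ℤ)))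
    {c : ℕ} (hc : c < D) :
    ∑ l ∈ (Polynomial.nthRoots D (1 : ℂ)).toFinset, Polynomial.C (l ^ (-(c : ℤ))) * P l =
      ∑ k : ∀ i, Fin (q i), if (∑ i, a i * (k i : ℕ)) % D = c then
        ((D : ℂ) ^ s)⁻¹ • expCoeffPolynomial s
          (expSeries (-(∑ i, a i * (k i : ℕ) : ℕ)) * toddSeries D ^ (s + 1)) else 0 := by
  have hD0 : (D : ℂ) ≠ 0 := by exact_mod_cast hD.ne'
  apply Polynomial.eq_of_infinite_eval_eq
  refine Set.infinite_of_injective_forall_mem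
    (f := fun m : ℕ => ((c + D * (m + ∑ i, a i * q i) : ℕ) : ℂ)) (fun m m' h => ?_) fun m => ?_
  · have h' : c + D * (m + ∑ i, a i * q i) = c + D * (m' + ∑ i, a i * q i) :=
      Nat.cast_injective (R := ℂ) h
    have := Nat.eq_of_mul_eq_mul_left hD (Nat.add_left_cancel h')
    omega
  · set n := c + D * (m + ∑ i, a i * q i) with hn
    have hnD : n % D = c := by rw [hn, Nat.add_mul_mod_self_left, Nat.mod_eq_of_lt hc]
    have hle : ∑ i, a i * q i ≤ n := by
      have := Nat.le_mul_of_pos_left (m + ∑ i, a i * q i) hD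
      omega
    rw [Set.mem_ofPred_eq, Polynomial.eval_finsetSum, Polynomial.eval_finsetSum]
    trans (restrictedPartition (s + 1) a n : ℂ)
    · rw [hP]
      refine Finset.sum_congr rfl fun l hl => ?_
      have hl : l ^ D = 1 := by simpa [Polynomial.mem_nthRoots hD] using hl
      rw [Polynomial.eval_mul, Polynomial.eval_C, mul_comm, zpow_neg, zpow_neg, zpow_natCast,
        zpow_natCast, hn, pow_add, pow_mul, hl, one_pow, mul_one]
    · rw [restrictedPartition_eq_sum_s19 hD hq hle, Nat.cast_sum]
      refine Finset.sum_congr rfl fun k _ => ?_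
      rw [hnD]
      split_ifs with h
      · set S := ∑ i, a i * (k i : ℕ)
        have hS : S ≤ n :=
          (Finset.sum_le_sum fun i _ => Nat.mul_le_mul_left _ (k i).2.le).trans hle
        have hdvd : D ∣ n - S := (Nat.modEq_iff_dvd' hS).1 (h.trans hnD.symm)
        have hexp : (n : ℂ) + -(S : ℂ) = ((n - S) / D : ℕ) * (D : ℂ) := by
          rw [← Nat.cast_mul, Nat.div_mul_cancel hdvd, Nat.cast_sub hS, sub_eq_add_neg]
        rw [Polynomial.eval_smul, eval_expCoeffPolynomial, ← mul_assoc, ← expSeries_add, hexp,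
          coeff_expSeries_mul_toddSeries_pow hD0, smul_eq_mul,
          inv_mul_cancel_left₀ (pow_ne_zero _ hD0)]
      · simp

open PowerSeries in
lemma sum_expSeries_mul_toddSeries_pow {r : ℕ} {a q : Fin r → ℕ} {D : ℕ}
    (ha : ∀ i, 0 < a i) (hq : ∀ i, a i * q i = D) :
    ∑ k : ∀ i, Fin (q i), expSeries (-(∑ i, a i * (k i : ℕ) : ℕ)) * toddSeries D ^ r =
      ((D : ℂ) ^ r * (1 / ∏ i, (a i : ℂ))) • ∏ i, toddSeries (a i) := by
  have h : ∀ k : ∀ i, Fin (q i), expSeries (-(∑ i, a i * (k i : ℕ) : ℕ)) =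
      ∏ i, expSeries (-((a i : ℂ) * (k i : ℕ))) := fun k => by
    rw [← expSeries_sum]
    congr 1
    push_cast
    rw [Finset.sum_neg_distrib]
  have ha' : ∀ i, (a i : ℂ) ≠ 0 := fun i => by exact_mod_cast (ha i).ne'
  have hD : ∀ i, (q i : ℂ) * a i = D := fun i => by rw [← hq i]; push_cast; ring
  have hq' : (D : ℂ) ^ r * (1 / ∏ i, (a i : ℂ)) = ∏ i, (q i : ℂ) := by
    rw [mul_one_div, div_eq_iff (Finset.prod_ne_zero_iff.2 fun i _ => ha' i),
      ← Finset.prod_mul_distrib]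
    simp [hD]
  rw [← Finset.sum_mul, Finset.sum_congr rfl fun k _ => h k, hq',
    ← Fintype.prod_sum fun i (j : Fin (q i)) => expSeries (-((a i : ℂ) * (j : ℕ))),
    ← Finset.prod_smul]
  have hpow : toddSeries D ^ r = ∏ i : Fin r, toddSeries (q i * a i) := by simp [hD]
  rw [hpow, ← Finset.prod_mul_distrib]
  exact Finset.prod_congr rfl fun i _ => sum_expSeries_mul_toddSeries (ha' i) (q i)

/-- Corollary 2.11 (Beck–Gessler–Komatsu): the polynomial part `P_a = P_1` of `p_a` is
`P_a(n) = (1/(a₁⋯a_r)) ∑_{u=0}^{r−1} ((−1)ᵘ/(r−1−u)!)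
∑_{i₁+⋯+i_r=u} (B_{i₁}⋯B_{i_r}/(i₁!⋯i_r!)) a₁^{i₁}⋯a_r^{i_r} n^{r−1−u}`. -/
theorem polynomial_part_bernoulli_formula
    (r : ℕ) (hr : 1 ≤ r) (a : Fin r → ℕ) (ha : ∀ i, 0 < a i)
    (D : ℕ) (hD : 0 < D) (hdvd : ∀ i, a i ∣ D)
    (P : ℂ → Polynomial ℂ)
    (hP : ∀ n : ℕ, (restrictedPartition r a n : ℂ) =
      ∑ l ∈ (Polynomial.nthRoots D (1 : ℂ)).toFinset, (P l).eval (n : ℂ) * l ^ (-(n : ℤ))) :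
    P 1 = ∑ u ∈ Finset.range r,
      Polynomial.C ((1 / ∏ i, (a i : ℂ)) * ((-1) ^ u / (Nat.factorial (r - 1 - u) : ℂ)) *
          ∑ iv ∈ Finset.Nat.antidiagonalTuple r u,
            ((∏ x, ((bernoulli (iv x) : ℚ) : ℂ)) / ∏ x, (Nat.factorial (iv x) : ℂ)) *
              ∏ x, (a x : ℂ) ^ (iv x)) *
        Polynomial.X ^ (r - 1 - u) := by
  obtain ⟨s, rfl⟩ : ∃ s, r = s + 1 := ⟨r - 1, by omega⟩
  choose q hq using hdvd
  have hq : ∀ i, a i * q i = D := fun i => (hq i).symm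
  have hD0 : (D : ℂ) ≠ 0 := by exact_mod_cast hD.ne'
  have hsum := Finset.sum_congr rfl fun c (hc : c ∈ Finset.range D) =>
    sum_C_mul_eq_of_restrictedPartition hD hq P hP (Finset.mem_range.1 hc)
  have hleft : ∑ c ∈ Finset.range D, ∑ l ∈ (Polynomial.nthRoots D (1 : ℂ)).toFinset,
      Polynomial.C (l ^ (-(c : ℤ))) * P l = (D : ℂ) • P 1 := by
    rw [Finset.sum_comm, Finset.sum_eq_single 1]
    · simp [Polynomial.smul_eq_C_mul]
    · intro l hl hl1
      have hl : l ^ D = 1 := by simpa [Polynomial.mem_nthRoots hD] using hl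
      rw [← Finset.sum_mul, ← map_sum, sum_zpow_neg_nthRoots hl, if_neg hl1, map_zero, zero_mul]
    · intro h
      simp [Polynomial.mem_nthRoots hD] at h
  have hright : (D : ℂ) • P 1 = (D : ℂ) • ((1 / ∏ i, (a i : ℂ)) •
      expCoeffPolynomial s (∏ i, toddSeries (a i))) := by
    rw [← hleft, hsum, Finset.sum_comm]
    simp only [Finset.sum_ite_eq, Finset.mem_range, Nat.mod_lt _ hD, if_true]
    rw [← Finset.smul_sum, ← map_sum, sum_expSeries_mul_toddSeries_pow ha hq, map_smul,
      smul_smul, smul_smul]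
    congr 1
    rw [pow_succ]
    field_simp
  rw [smul_right_injective _ hD0 hright]
  simp only [expCoeffPolynomial, LinearMap.sum_apply, LinearMap.comp_apply,
    LinearMap.smul_apply, PowerSeries.coeff_prod_toddSeries, Finset.smul_sum,
    Nat.add_sub_cancel]
  refine Finset.sum_congr rfl fun u _ => ?_
  rw [Polynomial.smul_monomial, Polynomial.C_mul_X_pow_eq_monomial]
  congr 1
  simp only [smul_eq_mul]
  ring
end
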